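/- Let n ≥ 2 and let A(s) = A₀ + sA₁, B(s) = B₀ + sB₁ ∈ F[s]^{n×n} be pencils with det(A₁) ≠ 0 and det(B₁) ≠ 0, having homogeneous invariant factors φ₁ | ⋯ | φ_n and ψ₁ | ⋯ | ψ_n respectively. Let 0 ≤ r ≤ n. If φ_{i−r}(s,t) | ψ_i(s,t) | φ_{i+r}(s,t) for 1 ≤ i ≤ n, then there exists a pencil P(s) ∈ F[s]^{n×n} of normal rank exactly r such that A(s) + P(s) is strictly equivalent to B(s). -/

import Mathlib

/-- A polynomial matrix is a (matrix) pencil if every entry has degree at most 1. -/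
def IsPencil {F : Type*} [Field F] {m n : ℕ} (M : Matrix (Fin m) (Fin n) (Polynomial F)) : Prop :=
  ∀ i j, (M i j).degree ≤ 1

/-- Normal rank of a polynomial matrix: its rank over the field of rational functions. -/
noncomputable def normalRank {F : Type*} [Field F] {m n : ℕ}
    (M : Matrix (Fin m) (Fin n) (Polynomial F)) : ℕ :=
  (M.map (algebraMap (Polynomial F) (RatFunc F))).rank

/-- Strict equivalence of polynomial matrices (pencils):
`G = Q * H * R` for invertible constant matrices `Q`, `R`. -/
def StrictEquiv {F : Type*} [Field F] {m n : ℕ}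
    (G H : Matrix (Fin m) (Fin n) (Polynomial F)) : Prop :=
  ∃ (Q : Matrix (Fin m) (Fin m) F) (R : Matrix (Fin n) (Fin n) F),
    IsUnit Q.det ∧ IsUnit R.det ∧ G = (Q.map Polynomial.C) * H * (R.map Polynomial.C)

/-- The pencil `G₀ + s G₁` as a polynomial matrix. -/
noncomputable def pencilOf {F : Type*} [Field F] {m n : ℕ}
    (G₀ G₁ : Matrix (Fin m) (Fin n) F) : Matrix (Fin m) (Fin n) (Polynomial F) :=
  G₀.map Polynomial.C + (Polynomial.X : Polynomial F) • G₁.map Polynomial.C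

/-- The homogeneous pencil `t G₀ + s G₁` (variables `s = X 0`, `t = X 1`). -/
noncomputable def homPencil {F : Type*} [Field F] {m n : ℕ}
    (G₀ G₁ : Matrix (Fin m) (Fin n) F) : Matrix (Fin m) (Fin n) (MvPolynomial (Fin 2) F) :=
  (MvPolynomial.X 1 : MvPolynomial (Fin 2) F) • G₀.map MvPolynomial.C +
    (MvPolynomial.X 0 : MvPolynomial (Fin 2) F) • G₁.map MvPolynomial.C

/-- The set of `k × k` minors of a matrix. -/
def minorsSet {R : Type*} [CommRing R] {m n : ℕ} (M : Matrix (Fin m) (Fin n) R) (k : ℕ) :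
    Set R :=
  { d | ∃ (ri : Fin k → Fin m) (ci : Fin k → Fin n),
      Function.Injective ri ∧ Function.Injective ci ∧ d = (M.submatrix ri ci).det }

/-- `g` is a greatest common divisor of the set `S`. -/
def IsGCDOf {R : Type*} [CommRing R] (g : R) (S : Set R) : Prop :=
  (∀ x ∈ S, g ∣ x) ∧ ∀ d : R, (∀ x ∈ S, d ∣ x) → d ∣ g

/-- `φ 0, …, φ (n-1)` are homogeneous invariant factors (up to units) of the pencil
`G₀ + s G₁`: for each `k ≤ n` the product of the first `k` of them is a gcd of the
`k × k` minors of the homogeneous pencil `t G₀ + s G₁`. -/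
def IsHomogeneousIF {F : Type*} [Field F] {n : ℕ} (G₀ G₁ : Matrix (Fin n) (Fin n) F)
    (φ : ℕ → MvPolynomial (Fin 2) F) : Prop :=
  ∀ k : ℕ, k ≤ n → IsGCDOf (∏ i ∈ Finset.range k, φ i) (minorsSet (homPencil G₀ G₁) k)

/-- Extension of a finite family of invariant factors (indexed `1, …, n`, stored with
offset `1` so that `φ 0` is the first one) to all integer indices, with the convention
that it is `1` below the range and `0` above it. -/
def extIF {R : Type*} [CommRing R] (n : ℕ) (φ : ℕ → R) : ℤ → R :=
  fun j => if j < 1 then 1 else if (n : ℤ) < j then 0 else φ (j - 1).toNat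

/-- Interlacing condition `φ_{i-r} ∣ ψ_i ∣ φ_{i+r}`, `1 ≤ i ≤ n`. -/
def Interlace {R : Type*} [CommRing R] (n r : ℕ) (φ ψ : ℕ → R) : Prop :=
  ∀ i : ℕ, 1 ≤ i → i ≤ n →
    extIF n φ ((i : ℤ) - r) ∣ extIF n ψ (i : ℤ) ∧
      extIF n ψ (i : ℤ) ∣ extIF n φ ((i : ℤ) + r)

/-- The operation `P_X` on pencils, acting on the pair `(G₀, G₁)` of coefficients of
`G(s) = G₀ + s G₁`: for `X = [[x, y], [z, w]]`,
`P_X(s G₁ + G₀) = s (x G₁ + z G₀) + (y G₁ + w G₀)`. -/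
def mapP {F : Type*} [Field F] {m n : ℕ} (X : Matrix (Fin 2) (Fin 2) F)
    (G : Matrix (Fin m) (Fin n) F × Matrix (Fin m) (Fin n) F) :
    Matrix (Fin m) (Fin n) F × Matrix (Fin m) (Fin n) F :=
  (X 0 1 • G.2 + X 1 1 • G.1, X 0 0 • G.2 + X 1 0 • G.1)

/-- The substitution `Π_X(Φ)(s, t) = Φ(s x + t y, s z + t w)` for `X = [[x, y], [z, w]]`. -/
noncomputable def PiX {F : Type*} [Field F] (X : Matrix (Fin 2) (Fin 2) F)
    (Φ : MvPolynomial (Fin 2) F) : MvPolynomial (Fin 2) F :=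
  MvPolynomial.aeval
    ![MvPolynomial.C (X 0 0) * MvPolynomial.X 0 + MvPolynomial.C (X 0 1) * MvPolynomial.X 1,
      MvPolynomial.C (X 1 0) * MvPolynomial.X 0 + MvPolynomial.C (X 1 1) * MvPolynomial.X 1] Φ

/-- The homogeneous invariant factor of a nonzero `1 × 1` pencil `a(s) = a₀ + s a₁`:
the homogenization `t a₀ + s a₁`, made monic with respect to `s`
(equal to `t` when `a₁ = 0`). -/
noncomputable def homIF1 {F : Type*} [Field F] (a : Polynomial F) : MvPolynomial (Fin 2) F :=
  MvPolynomial.C (a.leadingCoeff)⁻¹ *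
    (MvPolynomial.C (a.coeff 1) * MvPolynomial.X 0 + MvPolynomial.C (a.coeff 0) * MvPolynomial.X 1)

/-- The homogeneous pencil associated to a polynomial matrix pencil. -/
noncomputable def homOf {F : Type*} [Field F] {n : ℕ}
    (M : Matrix (Fin n) (Fin n) (Polynomial F)) : Matrix (Fin n) (Fin n) (MvPolynomial (Fin 2) F) :=
  homPencil (M.map fun p => p.coeff 0) (M.map fun p => p.coeff 1)

/-! ### Smith normal form over a Euclidean domain -/

/-- Two square matrices are unimodularly equivalent. -/
def UnimodularEquiv {R : Type*} [CommRing R] {n : ℕ} (C D : Matrix (Fin n) (Fin n) R) : Prop :=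
  ∃ U V : (Matrix (Fin n) (Fin n) R)ˣ, D = U.val * C * V.val

section Smith

variable {R : Type*} {n : ℕ}

theorem UnimodularEquiv.refl [CommRing R] (C : Matrix (Fin n) (Fin n) R) : UnimodularEquiv C C :=
  ⟨1, 1, by simp⟩

theorem UnimodularEquiv.symm [CommRing R] {C D : Matrix (Fin n) (Fin n) R}
    (h : UnimodularEquiv C D) : UnimodularEquiv D C := by
  obtain ⟨U, V, rfl⟩ := h
  refine ⟨U⁻¹, V⁻¹, ?_⟩
  simp [Matrix.mul_assoc]

theorem UnimodularEquiv.trans [CommRing R] {C D E : Matrix (Fin n) (Fin n) R}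
    (h : UnimodularEquiv C D) (h' : UnimodularEquiv D E) : UnimodularEquiv C E := by
  obtain ⟨U, V, rfl⟩ := h
  obtain ⟨U', V', rfl⟩ := h'
  exact ⟨U' * U, V * V', by simp [Matrix.mul_assoc]⟩

/-- The unimodular matrix `1 + x yᵀ` for `y ⬝ᵥ x = 0`. -/
def shear [CommRing R] (x y : Fin n → R) (h : y ⬝ᵥ x = 0) : (Matrix (Fin n) (Fin n) R)ˣ where
  val := 1 + Matrix.vecMulVec x y
  inv := 1 - Matrix.vecMulVec x y
  val_inv := by
    simp [mul_sub, add_mul, Matrix.vecMulVec_mul_vecMulVec, h]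
  inv_val := by
    simp [mul_add, sub_mul, Matrix.vecMulVec_mul_vecMulVec, h]

theorem UnimodularEquiv.addRow [CommRing R] (C : Matrix (Fin n) (Fin n) R) (k : Fin n)
    (x : Fin n → R) (hx : x k = 0) :
    UnimodularEquiv C (Matrix.of fun i j => C i j + x i * C k j) := by
  refine ⟨shear x (Pi.single k 1) (by simpa using hx), 1, ?_⟩
  ext i j
  simp [shear, add_mul, Matrix.vecMulVec_mul, Matrix.vecMulVec_apply]

theorem UnimodularEquiv.addCol [CommRing R] (C : Matrix (Fin n) (Fin n) R) (k : Fin n)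
    (y : Fin n → R) (hy : y k = 0) :
    UnimodularEquiv C (Matrix.of fun i j => C i j + C i k * y j) := by
  refine ⟨1, shear (Pi.single k 1) y (by simpa using hy), ?_⟩
  ext i j
  simp [shear, mul_add, Matrix.mul_vecMulVec, Matrix.vecMulVec_apply]

theorem UnimodularEquiv.exists_corner [CommRing R] (C : Matrix (Fin (n + 1)) (Fin (n + 1)) R)
    (i j : Fin (n + 1)) : ∃ D, UnimodularEquiv C D ∧ D 0 0 = C i j := by
  refine ⟨Matrix.swap R 0 i * C * Matrix.swap R j 0,
    ⟨Matrix.GeneralLinearGroup.swap R 0 i, Matrix.GeneralLinearGroup.swap R j 0, rfl⟩, ?_⟩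
  rw [Matrix.mul_swap_apply_right, Matrix.swap_mul_apply_left]

/-- The block diagonal matrix with blocks `a` and `E`. -/
def cornerBlock [Zero R] (a : R) (E : Matrix (Fin n) (Fin n) R) :
    Matrix (Fin (n + 1)) (Fin (n + 1)) R :=
  Matrix.of (Fin.cons (Fin.cons a 0) fun i => Fin.cons 0 (E i))

theorem cornerBlock_mul [CommRing R] (a b : R) (E E' : Matrix (Fin n) (Fin n) R) :
    cornerBlock a E * cornerBlock b E' = cornerBlock (a * b) (E * E') := by
  ext i j
  refine Fin.cases ?_ (fun i => ?_) i <;> refine Fin.cases ?_ (fun j => ?_) j <;>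
    simp [cornerBlock, Matrix.mul_apply, Fin.sum_univ_succ]

theorem cornerBlock_diagonal [CommRing R] (a : R) (d : Fin n → R) :
    cornerBlock a (Matrix.diagonal d) = Matrix.diagonal (Fin.cons a d : Fin (n + 1) → R) := by
  ext i j
  refine Fin.cases ?_ (fun i => ?_) i <;> refine Fin.cases ?_ (fun j => ?_) j <;>
    simp [cornerBlock, Matrix.diagonal_apply, (Fin.succ_ne_zero _).symm]

theorem cornerBlock_one [CommRing R] :
    cornerBlock 1 (1 : Matrix (Fin n) (Fin n) R) = 1 := by
  rw [← Matrix.diagonal_one, cornerBlock_diagonal, ← Matrix.diagonal_one]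
  congr 1
  ext i
  refine Fin.cases ?_ (fun i => ?_) i <;> simp

theorem UnimodularEquiv.cornerBlock [CommRing R] {E E' : Matrix (Fin n) (Fin n) R}
    (h : UnimodularEquiv E E') (a : R) :
    UnimodularEquiv (cornerBlock a E) (cornerBlock a E') := by
  obtain ⟨U, V, rfl⟩ := h
  let lift : (Matrix (Fin n) (Fin n) R)ˣ → (Matrix (Fin (n + 1)) (Fin (n + 1)) R)ˣ := fun W =>
    ⟨_root_.cornerBlock 1 W.val, _root_.cornerBlock 1 W.inv,
      by rw [cornerBlock_mul, W.val_inv, one_mul, cornerBlock_one],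
      by rw [cornerBlock_mul, W.inv_val, one_mul, cornerBlock_one]⟩
  exact ⟨lift U, lift V, by simp [lift, cornerBlock_mul]⟩

/-- A nonzero square matrix is equivalent to `diag(a, E)` with `a` dividing all entries of `E`. -/
theorem exists_unimodularEquiv_cornerBlock [EuclideanDomain R]
    (C : Matrix (Fin (n + 1)) (Fin (n + 1)) R) (hC : C ≠ 0) :
    ∃ a E, UnimodularEquiv C (cornerBlock a E) ∧ ∀ i j, a ∣ E i j := by
  let S : Set R := {a | a ≠ 0 ∧ ∃ D, UnimodularEquiv C D ∧ ∃ i j, D i j = a}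
  have hS : S.Nonempty := by
    by_contra h
    refine hC (Matrix.ext fun i j => ?_)
    by_contra h0
    exact h ⟨C i j, h0, C, .refl C, i, j, rfl⟩
  obtain ⟨a, ⟨ha0, D₀, hD₀, i₀, j₀, hij⟩, hmin⟩ :=
    (EuclideanDomain.r_wellFounded (R := R)).has_min S hS
  obtain ⟨D, hD, hDa⟩ := UnimodularEquiv.exists_corner D₀ i₀ j₀
  rw [hij] at hDa
  replace hD := hD₀.trans hD
  have dvd_of {x : R} (hx : ∃ D, UnimodularEquiv C D ∧ ∃ i j, D i j = x - a * (x / a)) :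
      a ∣ x := by
    rw [← EuclideanDomain.mod_eq_zero]
    by_contra hne
    refine hmin (x % a) ⟨hne, ?_⟩ (EuclideanDomain.mod_lt x ha0)
    rwa [EuclideanDomain.mod_eq_sub_mul_div]
  have row : ∀ M, UnimodularEquiv C M → M 0 0 = a → ∀ j, a ∣ M 0 j := by
    intro M hM hMa j
    rcases eq_or_ne j 0 with rfl | hj
    · rw [hMa]
    refine dvd_of ⟨_, hM.trans (.addCol M 0 (Pi.single j (-(M 0 j / a))) (by simp [hj.symm])),
      0, j, ?_⟩
    simp [hMa, sub_eq_add_neg]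
  have col : ∀ M, UnimodularEquiv C M → M 0 0 = a → ∀ i, a ∣ M i 0 := by
    intro M hM hMa i
    rcases eq_or_ne i 0 with rfl | hi
    · rw [hMa]
    refine dvd_of ⟨_, hM.trans (.addRow M 0 (Pi.single i (-(M i 0 / a))) (by simp [hi.symm])),
      i, 0, ?_⟩
    simp [hMa, sub_eq_add_neg, mul_comm]
  choose q hq using col D hD hDa
  have h1 := UnimodularEquiv.addRow D 0 (Fin.cons 0 fun i => -q i.succ) rfl
  set D1 : Matrix (Fin (n + 1)) (Fin (n + 1)) R := Matrix.of fun i j =>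
    D i j + (Fin.cons 0 fun i : Fin n => -q i.succ : Fin (n + 1) → R) i * D 0 j with hD1
  have h1a : D1 0 0 = a := by simp [hD1, hDa]
  have h1c (i : Fin n) : D1 i.succ 0 = 0 := by simp [hD1, hDa, hq i.succ, mul_comm]
  replace h1 := hD.trans h1
  choose p hp using row D1 h1 h1a
  have h2 := UnimodularEquiv.addCol D1 0 (Fin.cons 0 fun j => -p j.succ) rfl
  set D2 : Matrix (Fin (n + 1)) (Fin (n + 1)) R := Matrix.of fun i j =>
    D1 i j + D1 i 0 * (Fin.cons 0 fun j : Fin n => -p j.succ : Fin (n + 1) → R) j with hD2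
  have h2a : D2 0 0 = a := by simp [hD2, h1a]
  have h2c (i : Fin n) : D2 i.succ 0 = 0 := by simp [hD2, h1c]
  have h2r (j : Fin n) : D2 0 j.succ = 0 := by simp [hD2, h1a, hp j.succ]
  replace h2 := h1.trans h2
  refine ⟨a, Matrix.of fun i j => D2 i.succ j.succ, ?_, fun i j => ?_⟩
  · convert h2
    ext i j
    refine Fin.cases ?_ (fun i => ?_) i <;> refine Fin.cases ?_ (fun j => ?_) j <;>
      simp [_root_.cornerBlock, h2a, h2c, h2r]
  · have h3 := UnimodularEquiv.addRow D2 i.succ (Pi.single 0 1) (by simp)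
    have := row _ (h2.trans h3) (by simp [h2a, h2c]) j.succ
    simpa [h2r] using this

theorem exists_unimodularEquiv_diagonal [EuclideanDomain R] :
    ∀ (n : ℕ) (C : Matrix (Fin n) (Fin n) R), ∃ d : Fin n → R,
      UnimodularEquiv C (Matrix.diagonal d) ∧ ∀ i j, i ≤ j → d i ∣ d j := by
  intro n
  induction n with
  | zero => exact fun C => ⟨0, ⟨1, 1, Subsingleton.elim _ _⟩, fun i => i.elim0⟩
  | succ n ih =>
    intro C
    by_cases hC : C = 0
    · exact ⟨0, by simpa [hC] using .refl 0, fun _ _ _ => dvd_rfl⟩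
    obtain ⟨a, E, hE, hdvd⟩ := exists_unimodularEquiv_cornerBlock C hC
    obtain ⟨d, hd, hchain⟩ := ih E
    refine ⟨Fin.cons a d, ?_, ?_⟩
    · rw [← cornerBlock_diagonal]
      exact hE.trans (hd.cornerBlock a)
    · have had (i : Fin n) : a ∣ d i := by
        obtain ⟨U, V, h⟩ := hd
        have : d i = (U.val * E * V.val) i i := by rw [← h]; simp
        rw [this]
        simp only [Matrix.mul_apply, Finset.sum_mul]
        exact Finset.dvd_sum fun k _ => Finset.dvd_sum fun l _ =>
          Dvd.dvd.mul_right (Dvd.dvd.mul_left (hdvd _ _) _) _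
      intro i j
      refine Fin.cases ?_ (fun i => ?_) i <;> refine Fin.cases ?_ (fun j => ?_) j
      · simp
      · simpa using had j
      · intro h
        exact absurd h (by simp)
      · simpa using hchain i j

end Smith

/-! ### Determinantal divisors -/

section Minors

variable {R : Type*} [CommRing R] {n k : ℕ}

theorem dvd_det_mul {e : R} (P : Matrix (Fin k) (Fin n) R) (Q : Matrix (Fin n) (Fin k) R)
    (h : ∀ p : Fin k → Fin n, Function.Injective p → e ∣ (Q.submatrix p id).det) :
    e ∣ (P * Q).det := by
  have hrow : P * Q = fun i => ∑ j, P i j • Q j := by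
    ext i j
    simp [Matrix.mul_apply]
  have hdet : (P * Q).det = Matrix.detRowAlternating fun i => ∑ j, P i j • Q j := by
    rw [← hrow]
    rfl
  rw [hdet, ← AlternatingMap.coe_multilinearMap, MultilinearMap.map_sum]
  refine Finset.dvd_sum fun p _ => ?_
  rw [MultilinearMap.map_smul_univ, smul_eq_mul]
  refine Dvd.dvd.mul_left ?_ _
  by_cases hp : Function.Injective p
  · exact h p hp
  · rw [AlternatingMap.coe_multilinearMap, AlternatingMap.map_eq_zero_of_not_injective]
    · exact dvd_zero e
    · exact fun hinj => hp hinj.of_comp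

theorem dvd_minorsSet_mul_left {e : R} {N : Matrix (Fin n) (Fin n) R}
    (h : ∀ x ∈ minorsSet N k, e ∣ x) (M : Matrix (Fin n) (Fin n) R) :
    ∀ x ∈ minorsSet (M * N) k, e ∣ x := by
  rintro x ⟨ri, ci, -, hci, rfl⟩
  rw [Matrix.submatrix_mul M N ri id ci Function.bijective_id]
  exact dvd_det_mul _ _ fun p hp => h _ ⟨p, ci, hp, hci, rfl⟩

theorem dvd_minorsSet_transpose {e : R} {N : Matrix (Fin n) (Fin n) R}
    (h : ∀ x ∈ minorsSet N k, e ∣ x) : ∀ x ∈ minorsSet N.transpose k, e ∣ x := by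
  rintro x ⟨ri, ci, hri, hci, rfl⟩
  rw [← Matrix.det_transpose]
  exact h _ ⟨ci, ri, hci, hri, rfl⟩

theorem dvd_minorsSet_mul_right {e : R} {N : Matrix (Fin n) (Fin n) R}
    (h : ∀ x ∈ minorsSet N k, e ∣ x) (M : Matrix (Fin n) (Fin n) R) :
    ∀ x ∈ minorsSet (N * M) k, e ∣ x := by
  rw [← Matrix.transpose_transpose (N * M), Matrix.transpose_mul]
  exact dvd_minorsSet_transpose (dvd_minorsSet_mul_left (dvd_minorsSet_transpose h) _)

theorem UnimodularEquiv.dvd_minorsSet {C D : Matrix (Fin n) (Fin n) R} (hCD : UnimodularEquiv C D)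
    {e : R} (h : ∀ x ∈ minorsSet C k, e ∣ x) : ∀ x ∈ minorsSet D k, e ∣ x := by
  obtain ⟨U, V, rfl⟩ := hCD
  exact dvd_minorsSet_mul_right (dvd_minorsSet_mul_left h _) _

theorem UnimodularEquiv.isGCDOf {C D : Matrix (Fin n) (Fin n) R} (hCD : UnimodularEquiv C D)
    {g : R} (h : IsGCDOf g (minorsSet C k)) : IsGCDOf g (minorsSet D k) :=
  ⟨hCD.dvd_minorsSet h.1, fun d hd => h.2 d (hCD.symm.dvd_minorsSet hd)⟩

theorem prod_dvd_prod_of_injective {d : ℕ → R} (hd : ∀ i j, i ≤ j → j < n → d i ∣ d j)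
    (c : Fin k → Fin n) (hc : Function.Injective c) :
    ∏ i ∈ Finset.range k, d i ∣ ∏ i, d (c i) := by
  have hcard : (Finset.univ.image c).card = k := by
    rw [Finset.card_image_of_injective _ hc, Finset.card_fin]
  have himg : ∏ i, d (c i) = ∏ j ∈ Finset.univ.image c, d j := by
    rw [Finset.prod_image fun _ _ _ _ h => hc h]
  let e := (Finset.univ.image c).orderEmbOfFin hcard
  have hprod : ∏ j ∈ Finset.univ.image c, d j = ∏ i, d (e i) := by
    rw [← Finset.map_orderEmbOfFin_univ (Finset.univ.image c) hcard, Finset.prod_map]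
    rfl
  rw [himg, hprod, Finset.prod_range]
  refine Finset.prod_dvd_prod_of_dvd _ _ fun i _ => hd _ _ ?_ (e i).2
  have hmono : StrictMono fun i => (e i : ℕ) := fun a b hab => e.strictMono hab
  have key : ∀ m (hm : m < k), m ≤ (e ⟨m, hm⟩ : ℕ) := by
    intro m
    induction m with
    | zero => exact fun _ => Nat.zero_le _
    | succ m ih =>
      intro hm
      exact (Nat.succ_le_succ (ih (by omega))).trans
        (hmono (a := ⟨m, by omega⟩) (b := ⟨m + 1, hm⟩) (by simp))
  exact key i i.2

theorem isGCDOf_minorsSet_diagonal {d : ℕ → R} (hd : ∀ i j, i ≤ j → j < n → d i ∣ d j)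
    (hk : k ≤ n) :
    IsGCDOf (∏ i ∈ Finset.range k, d i)
      (minorsSet (Matrix.diagonal fun i : Fin n => d i) k) := by
  constructor
  · rintro x ⟨ri, ci, -, hci, rfl⟩
    rw [Matrix.det_apply]
    refine Finset.dvd_sum fun σ _ =>
      (Dvd.dvd.mul_left ?_ _).trans (by rw [Units.smul_def, zsmul_eq_mul])
    by_cases h : ∀ i, ri (σ i) = ci i
    · simpa [Matrix.diagonal_apply, h] using prod_dvd_prod_of_injective hd ci hci
    · push Not at h
      obtain ⟨i, hi⟩ := h
      rw [Finset.prod_eq_zero (Finset.mem_univ i)]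
      · exact dvd_zero _
      · simp [hi]
  · intro e he
    refine he _ ⟨Fin.castLE hk, Fin.castLE hk, Fin.castLE_injective hk,
      Fin.castLE_injective hk, ?_⟩
    rw [Matrix.submatrix_diagonal _ _ (Fin.castLE_injective hk), Matrix.det_diagonal,
      Finset.prod_range]
    rfl

theorem IsGCDOf.associated [IsDomain R] {S : Set R} {g g' : R} (h : IsGCDOf g S)
    (h' : IsGCDOf g' S) : Associated g g' :=
  associated_of_dvd_dvd (h'.2 g h.1) (h.2 g' h'.1)

theorem associated_of_prod_range_associated [IsDomain R] {d f : ℕ → R}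
    (h0 : ∏ i ∈ Finset.range n, f i ≠ 0)
    (h : ∀ k ≤ n, Associated (∏ i ∈ Finset.range k, d i) (∏ i ∈ Finset.range k, f i)) :
    ∀ i < n, Associated (d i) (f i) := by
  intro i hi
  have h1 := h (i + 1) hi
  rw [Finset.prod_range_succ, Finset.prod_range_succ, mul_comm, mul_comm _ (f i)] at h1
  refine h1.of_mul_right (h i hi.le) fun h2 => h0 ?_
  have hf : ∏ i ∈ Finset.range i, f i = 0 := by
    have := (h i hi.le).symm
    rwa [h2, associated_zero_iff_eq_zero] at this
  obtain ⟨j, hj, hj0⟩ := Finset.prod_eq_zero_iff.1 hf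
  exact Finset.prod_eq_zero (Finset.mem_range.2 ((Finset.mem_range.1 hj).trans hi)) hj0

end Minors

/-- A matrix whose determinantal divisors are the partial products of a sequence `f` is
unimodularly equivalent to a diagonal matrix whose entries are associated to those of `f`. -/
theorem exists_diagonal_of_isGCDOf {R : Type*} [EuclideanDomain R] {n : ℕ}
    (C : Matrix (Fin n) (Fin n) R) (f : ℕ → R) (h0 : ∏ i ∈ Finset.range n, f i ≠ 0)
    (hf : ∀ k ≤ n, IsGCDOf (∏ i ∈ Finset.range k, f i) (minorsSet C k)) :
    ∃ d : Fin n → R, UnimodularEquiv C (Matrix.diagonal d) ∧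
      ∀ i : Fin n, Associated (d i) (f i) := by
  obtain ⟨d, hd, hchain⟩ := exists_unimodularEquiv_diagonal n C
  let d' : ℕ → R := fun i => if h : i < n then d ⟨i, h⟩ else 0
  have hdd : d = fun i : Fin n => d' i := by
    ext i
    simp [d']
  have hchain' : ∀ i j, i ≤ j → j < n → d' i ∣ d' j := by
    intro i j hij hj
    simpa [d', hj, hij.trans_lt hj] using hchain ⟨i, hij.trans_lt hj⟩ ⟨j, hj⟩ hij
  refine ⟨d, hd, fun i => ?_⟩
  have := associated_of_prod_range_associated (d := d') h0 (fun k hk =>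
    (isGCDOf_minorsSet_diagonal hchain' hk).associated
      (by have := hd.isGCDOf (hf k hk); rwa [hdd] at this)) i i.2
  rw [hdd]
  exact this

/-! ### Low rank changes of the action of `X` -/

section Perturbation

open Polynomial

variable {F : Type*} [Field F]

/-- Two `F[X]`-modules can be identified as vector spaces in such a way that the actions of `X`
differ by a map of rank at most `r`. -/
def RankClose (F : Type*) [Field F] (r : ℕ) (M N : Type*)
    [AddCommGroup M] [Module F M] [Module F[X] M] [IsScalarTower F F[X] M]
    [AddCommGroup N] [Module F N] [Module F[X] N] [IsScalarTower F F[X] N] : Prop :=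
  ∃ θ : M ≃ₗ[F] N, (Algebra.lsmul F F M (X : F[X]) -
    θ.symm.toLinearMap ∘ₗ Algebra.lsmul F F N (X : F[X]) ∘ₗ θ.toLinearMap).rank ≤ r

variable {M N T : Type*}
  [AddCommGroup M] [Module F M] [Module F[X] M] [IsScalarTower F F[X] M]
  [AddCommGroup N] [Module F N] [Module F[X] N] [IsScalarTower F F[X] N]
  [AddCommGroup T] [Module F T] [Module F[X] T] [IsScalarTower F F[X] T]

theorem RankClose.of_linearEquiv (e : M ≃ₗ[F[X]] N) : RankClose F 0 M N := by
  refine ⟨e.restrictScalars F, ?_⟩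
  have : Algebra.lsmul F F M (X : F[X]) - (e.restrictScalars F).symm.toLinearMap ∘ₗ
      Algebra.lsmul F F N (X : F[X]) ∘ₗ (e.restrictScalars F).toLinearMap = 0 := by
    ext x
    rw [LinearMap.sub_apply, LinearMap.zero_apply, sub_eq_zero]
    apply (e.restrictScalars F).injective
    simp
  rw [this]
  simp

theorem RankClose.trans.{u} {M N L : Type u}
    [AddCommGroup M] [Module F M] [Module F[X] M] [IsScalarTower F F[X] M]
    [AddCommGroup N] [Module F N] [Module F[X] N] [IsScalarTower F F[X] N]
    [AddCommGroup L] [Module F L] [Module F[X] L] [IsScalarTower F F[X] L] {r s : ℕ}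
    (h : RankClose F r M N) (h' : RankClose F s N L) : RankClose F (r + s) M L := by
  obtain ⟨θ, hθ⟩ := h
  obtain ⟨η, hη⟩ := h'
  refine ⟨θ.trans η, ?_⟩
  have key : Algebra.lsmul F F M (X : F[X]) - (θ.trans η).symm.toLinearMap ∘ₗ
      Algebra.lsmul F F L (X : F[X]) ∘ₗ (θ.trans η).toLinearMap =
      (Algebra.lsmul F F M (X : F[X]) -
        θ.symm.toLinearMap ∘ₗ Algebra.lsmul F F N (X : F[X]) ∘ₗ θ.toLinearMap) +
      θ.symm.toLinearMap ∘ₗ (Algebra.lsmul F F N (X : F[X]) -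
        η.symm.toLinearMap ∘ₗ Algebra.lsmul F F L (X : F[X]) ∘ₗ η.toLinearMap) ∘ₗ
        θ.toLinearMap := by
    ext x
    simp
  rw [key, Nat.cast_add]
  exact (LinearMap.rank_add_le _ _).trans (add_le_add hθ
    ((LinearMap.rank_comp_le_right _ _).trans ((LinearMap.rank_comp_le_left _ _).trans hη)))

theorem LinearMap.rank_le_one_of_ker_le {V W : Type*} [AddCommGroup V] [Module F V]
    [AddCommGroup W] [Module F W] (l : V →ₗ[F] F) (E : V →ₗ[F] W)
    (h : ∀ v, l v = 0 → E v = 0) : E.rank ≤ 1 := by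
  by_cases hl : ∃ v, l v ≠ 0
  · obtain ⟨v, hv⟩ := hl
    have : LinearMap.range E ≤ Submodule.span F {E v} := by
      rintro _ ⟨w, rfl⟩
      refine Submodule.mem_span_singleton.2 ⟨l w / l v, ?_⟩
      have := h (w - (l w / l v) • v) (by simp [hv])
      rw [map_sub, map_smul, sub_eq_zero] at this
      exact this.symm
    exact (Submodule.rank_mono this).trans ((rank_span_le _).trans (by simp))
  · push Not at hl
    have : E = 0 := LinearMap.ext fun v => h v (hl v)
    simp [this]

/-- The map `(t, p) ↦ ι t + p • m` on pairs with `deg p < d`. -/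
noncomputable def cyclicExtensionMap (ι : T →ₗ[F[X]] M) (m : M) (d : ℕ) :
    (T × degreeLT F d) →ₗ[F] M :=
  (ι.restrictScalars F).coprod
    (((LinearMap.toSpanSingleton F[X] M m).restrictScalars F) ∘ₗ (degreeLT F d).subtype)

theorem cyclicExtensionMap_apply (ι : T →ₗ[F[X]] M) (m : M) (d : ℕ) (x : T × degreeLT F d) :
    cyclicExtensionMap ι m d x = ι x.1 + (x.2 : F[X]) • m := by
  simp [cyclicExtensionMap]

theorem finrank_degreeLT (d : ℕ) : Module.finrank F (degreeLT F d) = d := by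
  rw [(degreeLTEquiv F d).finrank_eq, Module.finrank_fin_fun]

theorem cyclicExtensionMap_bijective [FiniteDimensional F M] (ι : T →ₗ[F[X]] M)
    (hι : Function.Injective ι) (m : M) (hm : ∀ x, ∃ p : F[X], x - p • m ∈ LinearMap.range ι)
    (d : ℕ) (hd : Module.finrank F M = Module.finrank F T + d) :
    Function.Bijective (cyclicExtensionMap ι m d) := by
  have : FiniteDimensional F T :=
    FiniteDimensional.of_injective (ι.restrictScalars F) hι
  have : FiniteDimensional F (degreeLT F d) := (degreeLTEquiv F d).symm.finiteDimensional
  have hfin : Module.finrank F (T × degreeLT F d) = Module.finrank F M := by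
    rw [Module.finrank_prod, finrank_degreeLT, hd]
  suffices hs : Function.Surjective (cyclicExtensionMap ι m d) from
    ⟨(LinearMap.injective_iff_surjective_of_finrank_eq_finrank hfin).2 hs, hs⟩
  set a := (Algebra.lsmul F F (M ⧸ LinearMap.range ι) (X : F[X])).charpoly with ha
  have hmonic : a.Monic := LinearMap.charpoly_monic _
  have hdeg : a.natDegree = d := by
    have h1 := (LinearMap.range (ι.restrictScalars F)).finrank_quotient_add_finrank
    rw [LinearMap.finrank_range_of_inj (f := ι.restrictScalars F) hι, hd] at h1
    have h2 : Module.finrank F (M ⧸ LinearMap.range ι) =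
        Module.finrank F (M ⧸ LinearMap.range (ι.restrictScalars F)) := rfl
    rw [ha, LinearMap.charpoly_natDegree, h2]
    omega
  have hann : ∀ y : M, a • y ∈ LinearMap.range ι := by
    intro y
    rw [← Submodule.Quotient.mk_eq_zero, Submodule.Quotient.mk_smul]
    have h1 : Algebra.lsmul F F (M ⧸ LinearMap.range ι) a = 0 := by
      have := LinearMap.aeval_self_charpoly
        (Algebra.lsmul F F (M ⧸ LinearMap.range ι) (X : F[X]))
      rwa [← ha, Polynomial.aeval_algHom_apply, Polynomial.aeval_X_left_apply] at this
    exact LinearMap.congr_fun h1 (Submodule.Quotient.mk y)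
  intro x
  obtain ⟨p, t, ht⟩ := hm x
  obtain ⟨t', ht'⟩ := hann ((p /ₘ a) • m)
  refine ⟨(t + t', ⟨p %ₘ a, ?_⟩), ?_⟩
  · rw [mem_degreeLT, ← hdeg, ← degree_eq_natDegree hmonic.ne_zero]
    exact degree_modByMonic_lt p hmonic
  · rw [cyclicExtensionMap_apply, map_add, ht, ht', smul_smul]
    nth_rewrite 1 [← modByMonic_add_div p a]
    rw [add_smul]
    abel

theorem X_smul_cyclicExtensionMap (ι : T →ₗ[F[X]] M) (m : M) (d : ℕ) (x : T × degreeLT F d)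
    (hx : X * (x.2 : F[X]) ∈ degreeLT F d) :
    (X : F[X]) • cyclicExtensionMap ι m d x =
      cyclicExtensionMap ι m d ((X : F[X]) • x.1, ⟨X * (x.2 : F[X]), hx⟩) := by
  simp [cyclicExtensionMap_apply, mul_smul]

theorem X_mul_mem_degreeLT {d : ℕ} {p : F[X]} (hp : p ∈ degreeLT F d)
    (h : p.coeff (d - 1) = 0) : X * p ∈ degreeLT F d := by
  rw [mem_degreeLT, degree_lt_iff_coeff_zero] at *
  rintro (_ | k) hk
  · simp
  · rw [coeff_X_mul]
    rcases Nat.lt_or_ge k d with h1 | h1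
    · obtain rfl : k = d - 1 := by omega
      exact h
    · exact hp k h1

/-- Two modules of the same dimension which are extensions of cyclic modules by a common
module differ by a change of rank at most one. -/
theorem RankClose.of_common_submodule [FiniteDimensional F M] [FiniteDimensional F N]
    (hMN : Module.finrank F M = Module.finrank F N)
    (ι : T →ₗ[F[X]] M) (hι : Function.Injective ι) (m : M)
    (hm : ∀ x, ∃ p : F[X], x - p • m ∈ LinearMap.range ι)
    (κ : T →ₗ[F[X]] N) (hκ : Function.Injective κ) (m' : N)
    (hm' : ∀ x, ∃ p : F[X], x - p • m' ∈ LinearMap.range κ) : RankClose F 1 M N := by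
  obtain ⟨d, hd⟩ := Nat.exists_eq_add_of_le
    (LinearMap.finrank_le_finrank_of_injective (f := ι.restrictScalars F) hι)
  let Φ := LinearEquiv.ofBijective _ (cyclicExtensionMap_bijective ι hι m hm d hd)
  let Ψ := LinearEquiv.ofBijective _
    (cyclicExtensionMap_bijective κ hκ m' hm' d (hMN.symm.trans hd))
  refine ⟨Φ.symm.trans Ψ, ?_⟩
  rw [Nat.cast_one]
  refine LinearMap.rank_le_one_of_ker_le
    ((lcoeff F (d - 1)) ∘ₗ (degreeLT F d).subtype ∘ₗ LinearMap.snd F T _ ∘ₗ Φ.symm.toLinearMap)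
    _ fun v hv => ?_
  obtain ⟨x, rfl⟩ := Φ.surjective v
  have hx : X * (x.2 : F[X]) ∈ degreeLT F d := X_mul_mem_degreeLT x.2.2 (by simpa using hv)
  have h1 : (X : F[X]) • Φ x = Φ ((X : F[X]) • x.1, ⟨X * (x.2 : F[X]), hx⟩) :=
    X_smul_cyclicExtensionMap ι m d x hx
  have h2 : (X : F[X]) • Ψ x = Ψ ((X : F[X]) • x.1, ⟨X * (x.2 : F[X]), hx⟩) :=
    X_smul_cyclicExtensionMap κ m' d x hx
  rw [LinearMap.sub_apply, sub_eq_zero]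
  apply Φ.symm.injective
  simp [h1, h2]

end Perturbation

/-! ### Direct sums of cyclic modules -/

section CyclicSum

open Polynomial

/-- The direct sum of the cyclic modules `R / (f i)`, `i < n`. -/
abbrev CyclicSum {R : Type*} [CommRing R] (n : ℕ) (f : ℕ → R) : Type _ :=
  (i : Fin n) → R ⧸ Ideal.span {f i}

variable {R : Type*} [CommRing R] {m : ℕ}

/-- The vectors `e_{j+1} + c_j e_j`. -/
def chainVector (f c : ℕ → R) (j : Fin m) : CyclicSum (m + 1) f :=
  (Pi.single j.succ 1 : CyclicSum (m + 1) f) +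
    c j • (Pi.single j.castSucc 1 : CyclicSum (m + 1) f)

theorem CyclicSum.smul_single_eq_zero {n : ℕ} {f : ℕ → R} {i : Fin n} {a : R} (h : f i ∣ a) :
    a • (Pi.single i 1 : CyclicSum n f) = 0 := by
  rw [← Pi.single_smul, Algebra.smul_def, mul_one, Ideal.Quotient.algebraMap_eq,
    Ideal.Quotient.eq_zero_iff_mem.2 (Ideal.mem_span_singleton.2 h), Pi.single_zero]

theorem smul_chainVector {f c τ : ℕ → R} (h1 : ∀ j < m, f (j + 1) ∣ τ j)
    (h2 : ∀ j < m, f j = τ j * c j) (j : Fin m) : τ j • chainVector f c j = 0 := by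
  rw [chainVector, smul_add, smul_smul,
    CyclicSum.smul_single_eq_zero (h1 j j.2),
    CyclicSum.smul_single_eq_zero (i := j.castSucc) (dvd_of_eq (h2 j j.2)), add_zero]

/-- The map out of a direct sum of cyclic modules given by annihilated vectors. -/
def CyclicSum.lift {n : ℕ} {f : ℕ → R} {M : Type*} [AddCommGroup M] [Module R M] (v : Fin n → M)
    (hv : ∀ j : Fin n, f j • v j = 0) : CyclicSum n f →ₗ[R] M :=
  ∑ j : Fin n, (Submodule.liftQ (Ideal.span {f j}) (LinearMap.toSpanSingleton R _ (v j)) (by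
    rw [Ideal.span, Submodule.span_singleton_le_iff_mem, LinearMap.mem_ker,
      LinearMap.toSpanSingleton_apply, hv])) ∘ₗ LinearMap.proj j

theorem CyclicSum.lift_mk {n : ℕ} {f : ℕ → R} {M : Type*} [AddCommGroup M] [Module R M]
    (v : Fin n → M) (hv : ∀ j : Fin n, f j • v j = 0) (p : Fin n → R) :
    CyclicSum.lift (f := f) v hv (fun j => Ideal.Quotient.mk _ (p j)) = ∑ j, p j • v j := by
  simp only [CyclicSum.lift, LinearMap.sum_apply, LinearMap.comp_apply, LinearMap.proj_apply]
  rfl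

/-- The map from `⨁ R / (τ j)` sending the standard generators to the vectors
`e_{j+1} + c_j e_j`. -/
def chainMap {f c τ : ℕ → R} (h1 : ∀ j < m, f (j + 1) ∣ τ j) (h2 : ∀ j < m, f j = τ j * c j) :
    CyclicSum m τ →ₗ[R] CyclicSum (m + 1) f :=
  CyclicSum.lift (chainVector f c) (smul_chainVector h1 h2)

theorem chainMap_mk {f c τ : ℕ → R} (h1 : ∀ j < m, f (j + 1) ∣ τ j)
    (h2 : ∀ j < m, f j = τ j * c j) (p : Fin m → R) :
    chainMap h1 h2 (fun j => Ideal.Quotient.mk _ (p j)) = ∑ j, p j • chainVector f c j :=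
  CyclicSum.lift_mk _ _ p

theorem CyclicSum.single_one_apply {n : ℕ} {f : ℕ → R} (i k : Fin n) :
    (Pi.single k 1 : CyclicSum n f) i = Ideal.Quotient.mk _ (if i = k then 1 else 0) := by
  split_ifs with h
  · subst h
    simp
  · simp [h]

theorem sum_smul_chainVector_apply (f c : ℕ → R) (p : Fin m → R) (i : Fin (m + 1)) :
    (∑ j, p j • chainVector f c j) i = Ideal.Quotient.mk (Ideal.span {f i})
      (∑ j, p j * ((if i = j.succ then 1 else 0) + if i = j.castSucc then c j else 0)) := by
  rw [Finset.sum_apply, map_sum]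
  refine Finset.sum_congr rfl fun j _ => ?_
  rw [Pi.smul_apply, map_mul, chainVector, Pi.add_apply, Pi.smul_apply,
    CyclicSum.single_one_apply, CyclicSum.single_one_apply, Algebra.smul_def, Algebra.smul_def]
  split_ifs <;> simp

theorem chainMap_injective [IsDomain R] {f c τ : ℕ → R} (h1 : ∀ j < m, f (j + 1) ∣ τ j)
    (h2 : ∀ j < m, f j = τ j * c j) (hf : ∀ j < m, f j ≠ 0) :
    Function.Injective (chainMap h1 h2) := by
  rw [injective_iff_map_eq_zero]
  intro t ht
  choose p hp using fun j => Ideal.Quotient.mk_surjective (t j)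
  obtain rfl : (fun j => Ideal.Quotient.mk _ (p j)) = t := funext hp
  rw [chainMap_mk] at ht
  have hcomp (i : Fin (m + 1)) : f i ∣
      ∑ j, p j * ((if i = j.succ then 1 else 0) + if i = j.castSucc then c j else 0) := by
    have := congrFun ht i
    rwa [sum_smul_chainVector_apply, Pi.zero_apply, Ideal.Quotient.eq_zero_iff_mem,
      Ideal.mem_span_singleton] at this
  have cancel (j : ℕ) (hj : j < m) (q : R) (h : f j ∣ q * c j) : τ j ∣ q := by
    have hc : c j ≠ 0 := fun h0 => hf j hj (by rw [h2 j hj, h0, mul_zero])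
    rw [h2 j hj] at h
    exact (mul_dvd_mul_iff_right hc).1 h
  have key : ∀ j (hj : j < m), τ j ∣ p ⟨j, hj⟩ := by
    intro j
    induction j with
    | zero =>
      intro hj
      refine cancel 0 hj _ ?_
      have := hcomp 0
      rw [Finset.sum_eq_single ⟨0, hj⟩] at this
      · simpa [Fin.ext_iff] using this
      · intro b _ hb
        rw [if_neg (Fin.succ_ne_zero b).symm, if_neg, add_zero, mul_zero]
        exact fun h => hb (Fin.ext (by simpa using (congrArg Fin.val h).symm))
      · simp
    | succ j ih =>
      intro hj
      have hj' : j < m := by omega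
      refine cancel (j + 1) hj _ ?_
      have := hcomp ⟨j + 1, by omega⟩
      simp only [mul_add, Finset.sum_add_distrib] at this
      rw [Finset.sum_eq_single ⟨j, hj'⟩, Finset.sum_eq_single ⟨j + 1, hj⟩] at this
      · simp only [Fin.succ_mk, if_true, mul_one, Fin.castSucc_mk] at this
        exact (dvd_add_right ((h1 j hj').trans (ih hj'))).1 this
      · intro b _ hb
        rw [if_neg, mul_zero]
        exact fun h => hb (Fin.ext (by simpa using (congrArg Fin.val h).symm))
      · simp
      · intro b _ hb
        rw [if_neg, mul_zero]
        exact fun h => hb (Fin.ext (by simpa using (congrArg Fin.val h).symm))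
      · simp
  funext j
  exact Ideal.Quotient.eq_zero_iff_mem.2 (Ideal.mem_span_singleton.2 (key j j.2))

theorem CyclicSum.eq_sum_single {n : ℕ} {f : ℕ → R} (x : CyclicSum n f) :
    ∃ p : Fin n → R, x = ∑ i, p i • (Pi.single i 1 : CyclicSum n f) := by
  choose p hp using fun j => Ideal.Quotient.mk_surjective (x j)
  refine ⟨p, ?_⟩
  ext i
  rw [Finset.sum_apply, Finset.sum_eq_single i]
  · simp [← hp i, Algebra.smul_def]
  · intro b _ hb
    simp [hb.symm]
  · simp

theorem exists_sub_smul_mem_range_chainMap {f c τ : ℕ → R} (h1 : ∀ j < m, f (j + 1) ∣ τ j)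
    (h2 : ∀ j < m, f j = τ j * c j) (x : CyclicSum (m + 1) f) :
    ∃ p : R, x - p • (Pi.single 0 1 : CyclicSum (m + 1) f) ∈
      LinearMap.range (chainMap h1 h2) := by
  suffices h : x ∈ LinearMap.range (chainMap h1 h2) ⊔
      Submodule.span R {(Pi.single 0 1 : CyclicSum (m + 1) f)} by
    obtain ⟨y, hy, z, hz, rfl⟩ := Submodule.mem_sup.1 h
    obtain ⟨p, rfl⟩ := Submodule.mem_span_singleton.1 hz
    exact ⟨p, by rwa [add_sub_cancel_right]⟩
  have hsingle (i : Fin (m + 1)) : (Pi.single i 1 : CyclicSum (m + 1) f) ∈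
      LinearMap.range (chainMap h1 h2) ⊔
        Submodule.span R {(Pi.single 0 1 : CyclicSum (m + 1) f)} := by
    induction i using Fin.induction with
    | zero => exact Submodule.mem_sup_right (Submodule.mem_span_singleton_self _)
    | succ j ih =>
      have h3 : chainVector f c j ∈ LinearMap.range (chainMap h1 h2) := by
        refine ⟨fun k => Ideal.Quotient.mk _ ((Pi.single j 1 : Fin m → R) k), ?_⟩
        rw [chainMap_mk, Finset.sum_eq_single j]
        · simp
        · intro b _ hb
          simp [hb]
        · simp
      have h4 := Submodule.sub_mem _ (Submodule.mem_sup_left h3) (Submodule.smul_mem _ (c j) ih)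
      rwa [chainVector, add_sub_cancel_right] at h4
  obtain ⟨p, rfl⟩ := x.eq_sum_single
  exact Submodule.sum_mem _ fun i _ => Submodule.smul_mem _ _ (hsingle i)

variable {F : Type*} [Field F]

theorem finiteDimensional_quotient_span {p : F[X]} (hp : p ≠ 0) :
    FiniteDimensional F (F[X] ⧸ Ideal.span {p}) :=
  PowerBasis.finite (AdjoinRoot.powerBasis hp)

theorem CyclicSum.finiteDimensional {n : ℕ} {f : ℕ → F[X]} (hf : ∀ i < n, f i ≠ 0) :
    FiniteDimensional F (CyclicSum n f) := by
  have (i : Fin n) := finiteDimensional_quotient_span (hf i i.2)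
  infer_instance

theorem CyclicSum.finrank {n : ℕ} {f : ℕ → F[X]} (hf : ∀ i < n, f i ≠ 0) :
    Module.finrank F (CyclicSum n f) = ∑ i ∈ Finset.range n, (f i).natDegree := by
  have (i : Fin n) := finiteDimensional_quotient_span (hf i i.2)
  rw [Module.finrank_pi_fintype, Finset.sum_range]
  exact Finset.sum_congr rfl fun i _ => finrank_quotient_span_eq_natDegree

/-- Decreasing divisibility chains satisfying the rank one interlacing conditions. -/
theorem RankClose.cyclicSum_one {f g : ℕ → F[X]} (m : ℕ) (hf0 : ∀ i, f i ≠ 0) (hg0 : ∀ i, g i ≠ 0)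
    (hf : ∀ i, f (i + 1) ∣ f i) (hg : ∀ i, g (i + 1) ∣ g i)
    (hfg : ∀ i, f (i + 1) ∣ g i) (hgf : ∀ i, g (i + 1) ∣ f i)
    (hdeg : ∑ i ∈ Finset.range (m + 1), (f i).natDegree =
      ∑ i ∈ Finset.range (m + 1), (g i).natDegree) :
    RankClose F 1 (CyclicSum (m + 1) f) (CyclicSum (m + 1) g) := by
  classical
  let τ : ℕ → F[X] := fun j => EuclideanDomain.lcm (f (j + 1)) (g (j + 1))
  choose c hc using fun j => show τ j ∣ f j from EuclideanDomain.lcm_dvd (hf j) (hgf j)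
  choose b hb using fun j => show τ j ∣ g j from EuclideanDomain.lcm_dvd (hfg j) (hg j)
  have := CyclicSum.finiteDimensional (n := m + 1) fun i _ => hf0 i
  have := CyclicSum.finiteDimensional (n := m + 1) fun i _ => hg0 i
  exact RankClose.of_common_submodule
    (by rw [CyclicSum.finrank fun i _ => hf0 i, CyclicSum.finrank fun i _ => hg0 i, hdeg])
    (chainMap (fun j _ => EuclideanDomain.dvd_lcm_left _ _) (fun j _ => hc j))
    (chainMap_injective _ _ fun j _ => hf0 j) _ (exists_sub_smul_mem_range_chainMap _ _)
    (chainMap (fun j _ => EuclideanDomain.dvd_lcm_right _ _) (fun j _ => hb j))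
    (chainMap_injective _ _ fun j _ => hg0 j) _ (exists_sub_smul_mem_range_chainMap _ _)

theorem RankClose.cyclicSum_zero {f g : ℕ → F[X]} (n : ℕ) (hfg : ∀ i, f i ∣ g i)
    (hgf : ∀ i, g i ∣ f i) : RankClose F 0 (CyclicSum n f) (CyclicSum n g) :=
  RankClose.of_linearEquiv (LinearEquiv.piCongrRight fun i =>
    Submodule.quotEquivOfEq _ _ (Ideal.span_singleton_eq_span_singleton.2
      (associated_of_dvd_dvd (hfg i) (hgf i))))

end CyclicSum

/-! ### Interpolating between interlacing chains -/

section Interpolation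

theorem sum_range_eq_sum_layers (n T : ℕ) (a : ℕ → ℕ) (hT : ∀ j, a j ≤ T) :
    ∑ j ∈ Finset.range n, a j =
      ∑ t ∈ Finset.range T, ((Finset.range n).filter fun j => t < a j).card := by
  have h (j : ℕ) : a j = ∑ t ∈ Finset.range T, if t < a j then 1 else 0 := by
    rw [Finset.sum_boole, Nat.cast_id]
    have : (Finset.range T).filter (fun t => t < a j) = Finset.range (a j) := by
      ext t
      have := hT j
      simp only [Finset.mem_filter, Finset.mem_range]
      omega
    rw [this, Finset.card_range]
  rw [Finset.sum_congr rfl fun j _ => h j, Finset.sum_comm]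
  exact Finset.sum_congr rfl fun t _ => by rw [Finset.sum_boole, Nat.cast_id]

theorem Antitone.exists_lt_iff_lt {n : ℕ} {a : ℕ → ℕ} (ha : Antitone a)
    (han : ∀ j, n ≤ j → a j = 0) (t : ℕ) : ∃ α ≤ n, ∀ j, t < a j ↔ j < α := by
  have hex : ∃ j, a j ≤ t := ⟨n, by rw [han n le_rfl]; exact Nat.zero_le _⟩
  refine ⟨Nat.find hex, Nat.find_min' hex (by rw [han n le_rfl]; exact Nat.zero_le _),
    fun j => ⟨fun h => ?_, fun h => not_le.1 (Nat.find_min hex h)⟩⟩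
  by_contra! hj
  exact absurd (h.trans_le (ha hj)) (not_lt.2 (Nat.find_spec hex))

theorem sum_max_shift_le (n k : ℕ) (a b : ℕ → ℕ) (ha : Antitone a) (hb : Antitone b)
    (han : ∀ j, n ≤ j → a j = 0) (hbn : ∀ j, n ≤ j → b j = 0)
    (hab : ∀ j, a (j + (k + 1)) ≤ b j) (hba : ∀ j, b (j + (k + 1)) ≤ a j) :
    (k + 1) * ∑ j ∈ Finset.range n, max (a (j + 1)) (b (j + k)) ≤
      k * ∑ j ∈ Finset.range n, a j + ∑ j ∈ Finset.range n, b j := by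
  have hmaxT (j : ℕ) : max (a (j + 1)) (b (j + k)) ≤ a 0 + b 0 := by
    have := ha (Nat.zero_le (j + 1))
    have := hb (Nat.zero_le (j + k))
    omega
  rw [sum_range_eq_sum_layers n (a 0 + b 0) _ hmaxT,
    sum_range_eq_sum_layers n (a 0 + b 0) a
      (fun j => (ha (Nat.zero_le j)).trans (Nat.le_add_right _ _)),
    sum_range_eq_sum_layers n (a 0 + b 0) b
      (fun j => (hb (Nat.zero_le j)).trans (Nat.le_add_left _ _)),
    Finset.mul_sum, Finset.mul_sum, ← Finset.sum_add_distrib]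
  refine Finset.sum_le_sum fun t _ => ?_
  obtain ⟨α, hα, hα'⟩ := ha.exists_lt_iff_lt han t
  obtain ⟨β, hβ, hβ'⟩ := hb.exists_lt_iff_lt hbn t
  have card (γ : ℕ) (hγ : γ ≤ n) (p : ℕ → Prop) [DecidablePred p] (hp : ∀ j, p j ↔ j < γ) :
      ((Finset.range n).filter p).card = γ := by
    have : (Finset.range n).filter p = Finset.range γ := by
      ext j
      simp only [Finset.mem_filter, Finset.mem_range, hp]
      omega
    rw [this, Finset.card_range]
  rw [card α hα _ hα', card β hβ _ hβ', card (max (α - 1) (β - k)) (by omega)]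
  · have h1 : α ≤ β + (k + 1) := by
      by_contra! h
      have h2 := (hα' (β + (k + 1))).2 h
      exact lt_irrefl β ((hβ' β).1 (h2.trans_le (hab β)))
    have h2 : β ≤ α + (k + 1) := by
      by_contra! h
      have h2 := (hβ' (α + (k + 1))).2 h
      exact lt_irrefl α ((hα' α).1 (h2.trans_le (hba α)))
    rcases le_total (α - 1) (β - k) with h | h
    · rw [max_eq_right h]
      rcases Nat.lt_or_ge β k with h3 | h3
      · rw [Nat.sub_eq_zero_of_le h3.le]
        simp
      · obtain ⟨c, rfl⟩ := Nat.exists_eq_add_of_le h3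
        rw [Nat.add_sub_cancel_left]
        nlinarith
    · rw [max_eq_left h]
      rcases Nat.eq_zero_or_pos α with rfl | h3
      · simp
      · obtain ⟨c, rfl⟩ := Nat.exists_eq_add_of_le' h3
        rw [Nat.add_sub_cancel]
        nlinarith
  · intro j
    rw [lt_max_iff, hα', hβ']
    omega

open Polynomial UniqueFactorizationMonoid

variable {F : Type*} [Field F]

open Classical in
theorem Polynomial.natDegree_eq_sum_count_normalizedFactors {p W : F[X]} (hW : W ≠ 0) (h : p ∣ W) :
    p.natDegree =
      ∑ π ∈ (normalizedFactors W).toFinset, π.natDegree * (normalizedFactors p).count π := by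
  have hp : p ≠ 0 := ne_zero_of_dvd_ne_zero hW h
  have h0 : (0 : F[X]) ∉ normalizedFactors p := zero_notMem_normalizedFactors p
  have h1 := natDegree_eq_of_degree_eq
    (degree_eq_degree_of_associated (prod_normalizedFactors hp))
  rw [← h1, natDegree_multiset_prod _ h0, Finset.sum_multiset_map_count]
  refine (Finset.sum_congr rfl fun x _ => by rw [smul_eq_mul, mul_comm]).trans
    (Finset.sum_subset ?_ ?_)
  · intro x hx
    rw [Multiset.mem_toFinset] at *
    exact Multiset.mem_of_le ((dvd_iff_normalizedFactors_le_normalizedFactors hp hW).1 h) hx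
  · intro x _ hx
    rw [Multiset.mem_toFinset] at hx
    rw [Multiset.count_eq_zero_of_notMem hx, mul_zero]

open Classical in
theorem Polynomial.count_normalizedFactors_lcm_le {a b : F[X]} (ha : a ≠ 0) (hb : b ≠ 0)
    (π : F[X]) : (normalizedFactors (EuclideanDomain.lcm a b)).count π ≤
      max ((normalizedFactors a).count π) ((normalizedFactors b).count π) := by
  have hl : EuclideanDomain.lcm a b ≠ 0 := by
    rw [Ne, EuclideanDomain.lcm_eq_zero_iff]
    tauto
  have hg : EuclideanDomain.gcd a b ≠ 0 := by
    rw [Ne, EuclideanDomain.gcd_eq_zero_iff]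
    tauto
  have h1 := congrArg (fun q => (normalizedFactors q).count π) (EuclideanDomain.gcd_mul_lcm a b)
  simp only [normalizedFactors_mul hg hl, normalizedFactors_mul ha hb, Multiset.count_add] at h1
  suffices min ((normalizedFactors a).count π) ((normalizedFactors b).count π) ≤
      (normalizedFactors (EuclideanDomain.gcd a b)).count π by omega
  have hdvd (c : F[X]) (hc : c ≠ 0) (i : ℕ) (hi : i ≤ (normalizedFactors c).count π) :
      π ^ i ∣ c := by
    rw [Multiset.le_count_iff_replicate_le] at hi
    have := (Multiset.prod_dvd_prod_of_le hi).trans (prod_normalizedFactors hc).dvd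
    rwa [Multiset.prod_replicate] at this
  set i := min ((normalizedFactors a).count π) ((normalizedFactors b).count π) with hi
  rcases Nat.eq_zero_or_pos i with h | h
  · omega
  have hπ : π ∈ normalizedFactors a := Multiset.count_pos.1 (by omega)
  have h2 : π ^ i ∣ EuclideanDomain.gcd a b :=
    EuclideanDomain.dvd_gcd (hdvd a ha i (by omega)) (hdvd b hb i (by omega))
  rw [dvd_iff_normalizedFactors_le_normalizedFactors
    (pow_ne_zero _ (irreducible_of_normalized_factor π hπ).ne_zero) hg, normalizedFactors_pow,
    normalizedFactors_irreducible (irreducible_of_normalized_factor π hπ),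
    normalize_normalized_factor π hπ] at h2
  have := Multiset.count_le_of_le π h2
  simpa using this

theorem dvd_of_le_of_succ_dvd {R : Type*} [CommMonoid R] {f : ℕ → R}
    (hf : ∀ i, f (i + 1) ∣ f i) {i j : ℕ} (h : i ≤ j) : f j ∣ f i := by
  induction j, h using Nat.le_induction with
  | base => exact dvd_rfl
  | succ j _ ih => exact (hf j).trans ih

open Classical in
theorem sum_natDegree_lcm_shift_le (n k : ℕ) {f g : ℕ → F[X]} (hf0 : ∀ i, f i ≠ 0)
    (hg0 : ∀ i, g i ≠ 0) (hf : ∀ i, f (i + 1) ∣ f i) (hg : ∀ i, g (i + 1) ∣ g i)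
    (hfn : ∀ i, n ≤ i → IsUnit (f i)) (hgn : ∀ i, n ≤ i → IsUnit (g i))
    (hfg : ∀ i, f (i + (k + 1)) ∣ g i) (hgf : ∀ i, g (i + (k + 1)) ∣ f i) :
    (k + 1) * ∑ j ∈ Finset.range n,
        (EuclideanDomain.lcm (f (j + 1)) (g (j + k))).natDegree ≤
      k * ∑ j ∈ Finset.range n, (f j).natDegree + ∑ j ∈ Finset.range n, (g j).natDegree := by
  have hW : f 0 * g 0 ≠ 0 := mul_ne_zero (hf0 0) (hg0 0)
  have hfW (j : ℕ) : f j ∣ f 0 * g 0 :=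
    (dvd_of_le_of_succ_dvd hf (Nat.zero_le j)).trans (dvd_mul_right _ _)
  have hgW (j : ℕ) : g j ∣ f 0 * g 0 :=
    (dvd_of_le_of_succ_dvd hg (Nat.zero_le j)).trans (dvd_mul_left _ _)
  rw [Finset.sum_congr rfl fun j _ => natDegree_eq_sum_count_normalizedFactors hW
      (EuclideanDomain.lcm_dvd (hfW (j + 1)) (hgW (j + k))),
    Finset.sum_congr rfl fun j _ => natDegree_eq_sum_count_normalizedFactors hW (hfW j),
    Finset.sum_congr rfl fun j _ => natDegree_eq_sum_count_normalizedFactors hW (hgW j),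
    Finset.sum_comm, Finset.sum_comm (s := Finset.range n),
    Finset.sum_comm (s := Finset.range n), Finset.mul_sum, Finset.mul_sum,
    ← Finset.sum_add_distrib]
  refine Finset.sum_le_sum fun π _ => ?_
  rw [← Finset.mul_sum, ← Finset.mul_sum, ← Finset.mul_sum, mul_left_comm, mul_left_comm k,
    ← mul_add]
  refine Nat.mul_le_mul_left _ ?_
  have mono {p q : F[X]} (hq : q ≠ 0) (h : p ∣ q) :
      (normalizedFactors p).count π ≤ (normalizedFactors q).count π :=
    Multiset.count_le_of_le π ((dvd_iff_normalizedFactors_le_normalizedFactors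
      (ne_zero_of_dvd_ne_zero hq h) hq).1 h)
  have unit {p : F[X]} (hp : IsUnit p) : (normalizedFactors p).count π = 0 := by
    rw [normalizedFactors_of_isUnit hp, Multiset.count_zero]
  refine le_trans (Nat.mul_le_mul_left _ (Finset.sum_le_sum fun j _ =>
    count_normalizedFactors_lcm_le (hf0 (j + 1)) (hg0 (j + k)) π)) ?_
  exact sum_max_shift_le n k (fun j => (normalizedFactors (f j)).count π)
    (fun j => (normalizedFactors (g j)).count π)
    (antitone_nat_of_succ_le fun j => mono (hf0 j) (hf j))
    (antitone_nat_of_succ_le fun j => mono (hg0 j) (hg j))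
    (fun j hj => unit (hfn j hj)) (fun j hj => unit (hgn j hj))
    (fun j => mono (hg0 j) (hfg j)) (fun j => mono (hf0 j) (hgf j))

/-- Interlacing chains give cyclic sums which differ by a change of rank at most `r`. -/
theorem RankClose.cyclicSum_of_interlacing (n r : ℕ) {f g : ℕ → F[X]} (hf0 : ∀ i, f i ≠ 0)
    (hg0 : ∀ i, g i ≠ 0) (hf : ∀ i, f (i + 1) ∣ f i) (hg : ∀ i, g (i + 1) ∣ g i)
    (hfn : ∀ i, n ≤ i → IsUnit (f i)) (hgn : ∀ i, n ≤ i → IsUnit (g i))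
    (hfg : ∀ i, f (i + r) ∣ g i) (hgf : ∀ i, g (i + r) ∣ f i)
    (hdeg : ∑ i ∈ Finset.range n, (f i).natDegree = ∑ i ∈ Finset.range n, (g i).natDegree)
    (hn : 0 < n) :
    RankClose F r (CyclicSum n f) (CyclicSum n g) := by
  classical
  obtain ⟨m, rfl⟩ := Nat.exists_eq_add_of_le' hn
  induction r generalizing f with
  | zero => exact RankClose.cyclicSum_zero _ hfg hgf
  | succ k ih =>
    rcases Nat.eq_zero_or_pos k with rfl | hk
    · exact RankClose.cyclicSum_one m hf0 hg0 hf hg hfg hgf hdeg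
    have hle := sum_natDegree_lcm_shift_le (m + 1) k hf0 hg0 hf hg hfn hgn hfg hgf
    rw [← hdeg, ← add_one_mul] at hle
    obtain ⟨e, he⟩ := Nat.exists_eq_add_of_le (Nat.le_of_mul_le_mul_left hle k.succ_pos)
    let σ : ℕ → F[X] := fun j => EuclideanDomain.lcm (f (j + 1)) (g (j + k))
    have hσ0 (j : ℕ) : σ j ≠ 0 := by
      rw [Ne, EuclideanDomain.lcm_eq_zero_iff]
      exact not_or.2 ⟨hf0 _, hg0 _⟩
    let ρ : ℕ → F[X] := fun j => (if j = 0 then X ^ e else 1) * σ j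
    have hρ_succ (j : ℕ) : ρ (j + 1) = σ (j + 1) := by simp [ρ]
    have hσρ (j : ℕ) : σ j ∣ ρ j := dvd_mul_left _ _
    have hσ_dvd (j : ℕ) (q : F[X]) (h1 : f (j + 1) ∣ q) (h2 : g (j + k) ∣ q) : σ j ∣ q :=
      EuclideanDomain.lcm_dvd h1 h2
    have hfσ (j : ℕ) : f (j + 1) ∣ σ j := EuclideanDomain.dvd_lcm_left _ _
    have hgσ (j : ℕ) : g (j + k) ∣ σ j := EuclideanDomain.dvd_lcm_right _ _
    have hgle {i j : ℕ} (h : i ≤ j) : g j ∣ g i := dvd_of_le_of_succ_dvd hg h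
    have hρ0 (j : ℕ) : ρ j ≠ 0 := by
      refine mul_ne_zero ?_ (hσ0 j)
      split_ifs
      exacts [pow_ne_zero _ X_ne_zero, one_ne_zero]
    have hρ (j : ℕ) : ρ (j + 1) ∣ ρ j := by
      rw [hρ_succ]
      exact (hσ_dvd _ _ ((hf _).trans (hfσ j))
        ((hgle (by omega)).trans (hgσ j))).trans (hσρ j)
    have hρf (j : ℕ) : ρ (j + 1) ∣ f j := by
      rw [hρ_succ]
      exact hσ_dvd _ _ ((hf _).trans (hf _)) (by
        rw [show j + 1 + k = j + (k + 1) by omega]; exact hgf j)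
    have hρdeg : ∑ i ∈ Finset.range (m + 1), (ρ i).natDegree =
        ∑ i ∈ Finset.range (m + 1), (f i).natDegree := by
      rw [he, Finset.sum_range_succ', Finset.sum_range_succ', Finset.sum_congr rfl fun j _ => by
        rw [hρ_succ]]
      have : (ρ 0).natDegree = e + (σ 0).natDegree := by
        simp only [ρ, if_true]
        rw [natDegree_mul (pow_ne_zero _ X_ne_zero) (hσ0 0), natDegree_X_pow]
      rw [this]
      simp only [σ]
      omega
    have h1 : RankClose F 1 (CyclicSum (m + 1) f) (CyclicSum (m + 1) ρ) :=
      RankClose.cyclicSum_one m hf0 hρ0 hf hρ (fun j => (hfσ j).trans (hσρ j)) hρf hρdeg.symm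
    have h2 : RankClose F k (CyclicSum (m + 1) ρ) (CyclicSum (m + 1) g) := by
      refine ih hρ0 hρ ?_ (fun j => (hgσ j).trans (hσρ j)) ?_ (hρdeg.trans hdeg)
      · intro j
        rw [show j + k = j + (k - 1) + 1 by omega, hρ_succ]
        refine hσ_dvd _ _ ?_ (hgle (by omega))
        rw [show j + (k - 1) + 1 + 1 = j + (k + 1) by omega]
        exact hfg j
      · rintro (_ | j) hj
        · omega
        · rw [hρ_succ]
          exact isUnit_of_dvd_unit (hσ_dvd _ 1 (hfn _ (by omega)).dvd (hgn _ (by omega)).dvd)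
            isUnit_one
    rw [add_comm]
    exact h1.trans h2

end Interpolation

/-! ### Dehomogenization -/

section Dehomogenization

open Polynomial

variable {F : Type*} [Field F]

/-- The substitution `s ↦ s`, `t ↦ 1`. -/
noncomputable def dehomogenize : MvPolynomial (Fin 2) F →ₐ[F] F[X] :=
  MvPolynomial.aeval ![X, 1]

theorem dehomogenize_homogenize {k : ℕ} {p : F[X]} (hp : p.natDegree ≤ k) :
    dehomogenize (p.homogenize k) = p :=
  aeval_homogenize_X_one p hp

theorem MvPolynomial.IsHomogeneous.natDegree_dehomogenize_le {k : ℕ}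
    {m : MvPolynomial (Fin 2) F} (hm : m.IsHomogeneous k) :
    (dehomogenize m).natDegree ≤ k := by
  rw [m.as_sum, map_sum]
  refine natDegree_sum_le_of_forall_le _ _ fun s hs => ?_
  have hs' : s 0 + s 1 = k := by
    have := hm (MvPolynomial.mem_support_iff.1 hs)
    rw [Finsupp.weight_apply, Finsupp.sum_fintype _ _ (by simp)] at this
    simpa using this
  rw [dehomogenize, MvPolynomial.aeval_monomial, Finsupp.prod_fintype _ _ (by simp)]
  simp only [Fin.prod_univ_two, Matrix.cons_val_zero, Matrix.cons_val_one, one_pow, mul_one]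
  exact (natDegree_C_mul_X_pow_le _ _).trans (by omega)

theorem MvPolynomial.IsHomogeneous.homogenize_dvd {k : ℕ} {m : MvPolynomial (Fin 2) F}
    (hm : m.IsHomogeneous k) {d : F[X]} (hd : d ∣ dehomogenize m) :
    d.homogenize d.natDegree ∣ m := by
  have hdeg := hm.natDegree_dehomogenize_le
  obtain ⟨e, he⟩ := hd
  rw [← homogenize_eq_of_isHomogeneous hm rfl]
  change _ ∣ (dehomogenize m).homogenize k
  rcases eq_or_ne (dehomogenize m) 0 with h0 | h0
  · simp [h0]
  rw [he] at h0 hdeg ⊢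
  rw [natDegree_mul (left_ne_zero_of_mul h0) (right_ne_zero_of_mul h0)] at hdeg
  rw [← Nat.add_sub_of_le (show d.natDegree ≤ k by omega),
    homogenize_mul d e le_rfl (by omega)]
  exact dvd_mul_right _ _

theorem map_homPencil {n : ℕ} (A₀ A₁ : Matrix (Fin n) (Fin n) F) :
    (homPencil A₀ A₁).map dehomogenize = pencilOf A₀ A₁ := by
  ext i j : 2
  simp [homPencil, pencilOf, dehomogenize]

theorem isHomogeneous_det_homPencil {n k : ℕ} (A₀ A₁ : Matrix (Fin n) (Fin n) F)
    (ri ci : Fin k → Fin n) : ((homPencil A₀ A₁).submatrix ri ci).det.IsHomogeneous k := by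
  rw [Matrix.det_apply]
  refine MvPolynomial.IsHomogeneous.sum _ _ _ fun σ _ => ?_
  have h1 (i j : Fin n) : (homPencil A₀ A₁ i j).IsHomogeneous 1 := by
    have h2 := ((MvPolynomial.isHomogeneous_X F (1 : Fin 2)).mul
        (MvPolynomial.isHomogeneous_C (Fin 2) (A₀ i j))).add
      ((MvPolynomial.isHomogeneous_X F (0 : Fin 2)).mul
        (MvPolynomial.isHomogeneous_C (Fin 2) (A₁ i j)))
    simpa [homPencil] using h2
  have h3 := MvPolynomial.IsHomogeneous.prod Finset.univ
    (fun i => (homPencil A₀ A₁).submatrix ri ci (σ i) i) (fun _ => 1) fun i _ => h1 _ _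
  rw [Finset.sum_const, Finset.card_univ, Fintype.card_fin, smul_eq_mul, mul_one] at h3
  rcases Int.units_eq_one_or (Equiv.Perm.sign σ) with h | h
  · simpa [h] using h3
  · simpa [h] using h3.neg

theorem dehomogenize_det {n k : ℕ} (A₀ A₁ : Matrix (Fin n) (Fin n) F) (ri ci : Fin k → Fin n) :
    dehomogenize ((homPencil A₀ A₁).submatrix ri ci).det =
      ((pencilOf A₀ A₁).submatrix ri ci).det := by
  rw [← map_homPencil, AlgHom.map_det]
  rfl

theorem IsHomogeneousIF.isGCDOf {n : ℕ} {A₀ A₁ : Matrix (Fin n) (Fin n) F}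
    {φ : ℕ → MvPolynomial (Fin 2) F} (hφ : IsHomogeneousIF A₀ A₁ φ) {k : ℕ} (hk : k ≤ n) :
    IsGCDOf (∏ i ∈ Finset.range k, dehomogenize (φ i)) (minorsSet (pencilOf A₀ A₁) k) := by
  obtain ⟨h1, h2⟩ := hφ k hk
  have hprod : ∏ i ∈ Finset.range k, dehomogenize (φ i) =
      dehomogenize (∏ i ∈ Finset.range k, φ i) := (map_prod dehomogenize φ _).symm
  rw [hprod]
  refine ⟨fun x hx => ?_, fun d hd => ?_⟩
  · obtain ⟨ri, ci, hri, hci, rfl⟩ := hx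
    obtain ⟨c, hc⟩ := h1 _ ⟨ri, ci, hri, hci, rfl⟩
    exact ⟨dehomogenize c, by rw [← dehomogenize_det, hc, map_mul]⟩
  · have h3 : d.homogenize d.natDegree ∣ ∏ i ∈ Finset.range k, φ i := by
      refine h2 _ fun x hx => ?_
      obtain ⟨ri, ci, hri, hci, rfl⟩ := hx
      refine (isHomogeneous_det_homPencil A₀ A₁ ri ci).homogenize_dvd ?_
      rw [dehomogenize_det]
      exact hd _ ⟨ri, ci, hri, hci, rfl⟩
    have h4 := map_dvd dehomogenize h3
    rwa [dehomogenize_homogenize le_rfl] at h4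

theorem coeff_det_pencilOf {n : ℕ} (A₀ A₁ : Matrix (Fin n) (Fin n) F) :
    (pencilOf A₀ A₁).det.coeff n = A₁.det := by
  have := Polynomial.coeff_det_X_add_C_card A₁ A₀
  rw [Fintype.card_fin] at this
  rw [← this, pencilOf, add_comm]

theorem natDegree_det_pencilOf {n : ℕ} (A₀ : Matrix (Fin n) (Fin n) F)
    {A₁ : Matrix (Fin n) (Fin n) F} (h : A₁.det ≠ 0) : (pencilOf A₀ A₁).det.natDegree = n := by
  refine le_antisymm ?_ (le_natDegree_of_ne_zero (by rwa [coeff_det_pencilOf]))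
  have := Polynomial.natDegree_det_X_add_C_le A₁ A₀
  rwa [Fintype.card_fin, add_comm] at this

theorem det_pencilOf_ne_zero {n : ℕ} (A₀ : Matrix (Fin n) (Fin n) F)
    {A₁ : Matrix (Fin n) (Fin n) F} (h : A₁.det ≠ 0) : (pencilOf A₀ A₁).det ≠ 0 := by
  intro h0
  exact h (by rw [← coeff_det_pencilOf A₀, h0, coeff_zero])

theorem IsHomogeneousIF.exists_diagonal {n : ℕ} {A₀ A₁ : Matrix (Fin n) (Fin n) F}
    {φ : ℕ → MvPolynomial (Fin 2) F} (hφ : IsHomogeneousIF A₀ A₁ φ) (h : A₁.det ≠ 0) :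
    ∃ d : Fin n → F[X], UnimodularEquiv (pencilOf A₀ A₁) (Matrix.diagonal d) ∧
      ∀ i : Fin n, Associated (d i) (dehomogenize (φ i)) := by
  refine exists_diagonal_of_isGCDOf _ (fun i => dehomogenize (φ i)) ?_ fun k hk => hφ.isGCDOf hk
  refine ne_zero_of_dvd_ne_zero (det_pencilOf_ne_zero A₀ h) ((hφ.isGCDOf le_rfl).1 _ ?_)
  exact ⟨id, id, Function.injective_id, Function.injective_id, by rw [Matrix.submatrix_id_id]⟩

theorem UnimodularEquiv.sum_natDegree {n : ℕ} {A₀ A₁ : Matrix (Fin n) (Fin n) F}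
    (h : A₁.det ≠ 0) {d : Fin n → F[X]}
    (hd : UnimodularEquiv (pencilOf A₀ A₁) (Matrix.diagonal d)) :
    (∀ i, d i ≠ 0) ∧ ∑ i, (d i).natDegree = n := by
  obtain ⟨U, V, hUV⟩ := hd
  have h1 : Associated (pencilOf A₀ A₁).det (∏ i, d i) := by
    rw [← Matrix.det_diagonal, hUV, Matrix.det_mul, Matrix.det_mul]
    have hU : IsUnit U.val.det := (Matrix.isUnit_iff_isUnit_det _).1 U.isUnit
    have hV : IsUnit V.val.det := (Matrix.isUnit_iff_isUnit_det _).1 V.isUnit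
    refine Associated.symm ((associated_mul_unit_left _ _ hV).trans ?_)
    rw [mul_comm]
    exact associated_mul_unit_left _ _ hU
  have h0 : ∏ i, d i ≠ 0 := h1.ne_zero_iff.1 (det_pencilOf_ne_zero A₀ h)
  have h2 : ∀ i, d i ≠ 0 := fun i => Finset.prod_ne_zero_iff.1 h0 i (Finset.mem_univ i)
  refine ⟨h2, ?_⟩
  rw [← natDegree_prod _ _ fun i _ => h2 i]
  exact (natDegree_eq_of_degree_eq (degree_eq_degree_of_associated h1)).symm.trans
    (natDegree_det_pencilOf A₀ h)

end Dehomogenization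

/-! ### The module of a regular pencil -/

section PencilModule

open Polynomial Module

variable {F : Type*} [Field F]

theorem CyclicSum.nonempty_linearEquiv {n : ℕ} {f : ℕ → F[X]} {M : Type*} [AddCommGroup M]
    [Module F M] [Module F[X] M] [IsScalarTower F F[X] M]
    (v : Fin n → M) (hspan : Submodule.span F[X] (Set.range v) = ⊤) (hf0 : ∀ i, f i ≠ 0)
    (hfv : ∀ i : Fin n, f i • v i = 0)
    (hdeg : Module.finrank F M = ∑ i ∈ Finset.range n, (f i).natDegree) :
    Nonempty (CyclicSum n f ≃ₗ[F[X]] M) := by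
  have hsurj : Function.Surjective (CyclicSum.lift v hfv) := by
    intro x
    have hx : x ∈ Submodule.span F[X] (Set.range v) := hspan ▸ Submodule.mem_top
    obtain ⟨p, rfl⟩ := (Submodule.mem_span_range_iff_exists_fun F[X]).1 hx
    exact ⟨fun j => Ideal.Quotient.mk _ (p j), CyclicSum.lift_mk v hfv p⟩
  have := CyclicSum.finiteDimensional (n := n) fun i _ => hf0 i
  have : FiniteDimensional F M :=
    Module.Finite.of_surjective ((CyclicSum.lift v hfv).restrictScalars F) hsurj
  have hinj : Function.Injective ((CyclicSum.lift v hfv).restrictScalars F) :=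
    (LinearMap.injective_iff_surjective_of_finrank_eq_finrank
      (by rw [CyclicSum.finrank fun i _ => hf0 i, hdeg])).2 hsurj
  exact ⟨LinearEquiv.ofBijective _ ⟨hinj, hsurj⟩⟩

variable {n : ℕ}

/-- The evaluation `F[X]ⁿ → Fⁿ` at a matrix `C`. -/
noncomputable def evalVec (C : Matrix (Fin n) (Fin n) F) :
    (Fin n → F[X]) →ₗ[F[X]] AEval' (Matrix.toLin' C) :=
  Fintype.linearCombination F[X] fun i => AEval'.of (Matrix.toLin' C) (Pi.single i 1)

theorem evalVec_C (C : Matrix (Fin n) (Fin n) F) (x : Fin n → F) :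
    evalVec C (fun i => Polynomial.C (x i)) = AEval'.of (Matrix.toLin' C) x := by
  rw [evalVec, Fintype.linearCombination_apply]
  conv_rhs => rw [pi_eq_sum_univ' x, map_sum]
  refine Finset.sum_congr rfl fun i _ => ?_
  rw [AEval.C_smul, map_smul]

theorem evalVec_surjective (C : Matrix (Fin n) (Fin n) F) : Function.Surjective (evalVec C) := by
  intro y
  obtain ⟨x, rfl⟩ := (AEval'.of (Matrix.toLin' C)).surjective y
  exact ⟨_, evalVec_C C x⟩

theorem evalVec_X_sub_mulVec (C : Matrix (Fin n) (Fin n) F) (w : Fin n → F[X]) :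
    evalVec C (((X : F[X]) • (1 : Matrix (Fin n) (Fin n) F[X]) - C.map Polynomial.C).mulVec w) =
      0 := by
  suffices h : evalVec C ∘ₗ
      ((X : F[X]) • (1 : Matrix (Fin n) (Fin n) F[X]) - C.map Polynomial.C).mulVecLin = 0 from
    LinearMap.congr_fun h w
  refine LinearMap.pi_ext' fun j => LinearMap.ext_ring ?_
  rw [LinearMap.comp_apply, LinearMap.comp_apply, LinearMap.single_apply,
    Matrix.mulVecLin_apply, Matrix.sub_mulVec, Matrix.smul_mulVec, Matrix.one_mulVec, map_sub,
    map_smul]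
  have h1 : (Pi.single j 1 : Fin n → F[X]) =
      fun i => Polynomial.C ((Pi.single j 1 : Fin n → F) i) := by
    ext1 i
    by_cases h : i = j
    · subst h; simp
    · simp [h]
  have h2 : (C.map Polynomial.C).mulVec (Pi.single j 1) =
      fun i => Polynomial.C ((C.mulVec (Pi.single j 1)) i) := by
    ext1 i
    simp
  rw [h2, evalVec_C, h1, evalVec_C, AEval'.X_smul_of]
  simp

theorem exists_cyclicSum_linearEquiv_aeval {A₀ A₁ : Matrix (Fin n) (Fin n) F} (h : IsUnit A₁.det)
    {d : Fin n → F[X]} (hd : UnimodularEquiv (pencilOf A₀ A₁) (Matrix.diagonal d))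
    {f : ℕ → F[X]} (hf0 : ∀ i, f i ≠ 0) (hdf : ∀ i : Fin n, Associated (d i.rev) (f i)) :
    Nonempty (CyclicSum n f ≃ₗ[F[X]] AEval' (Matrix.toLin' (-(A₁⁻¹ * A₀)))) := by
  have hdeg := (hd.sum_natDegree h.ne_zero).2
  obtain ⟨U, V, hUV⟩ := hd
  set W : Matrix (Fin n) (Fin n) F[X] := A₁⁻¹.map Polynomial.C * (U⁻¹).val with hW
  have hA : A₁⁻¹.map Polynomial.C * pencilOf A₀ A₁ =
      (X : F[X]) • (1 : Matrix (Fin n) (Fin n) F[X]) - (-(A₁⁻¹ * A₀)).map Polynomial.C := by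
    rw [pencilOf, Matrix.mul_add, Matrix.mul_smul, ← Matrix.map_mul, ← Matrix.map_mul,
      Matrix.nonsing_inv_mul _ h, Matrix.map_one _ (map_zero _) (map_one _)]
    rw [show (-(A₁⁻¹ * A₀)).map C = -(A₁⁻¹ * A₀).map C from
        Matrix.ext fun i j => map_neg C _, sub_neg_eq_add, add_comm]
  have hWD : W * Matrix.diagonal d = ((X : F[X]) • (1 : Matrix (Fin n) (Fin n) F[X]) -
      (-(A₁⁻¹ * A₀)).map Polynomial.C) * V.val := by
    rw [hW, hUV, ← hA]
    simp only [Matrix.mul_assoc]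
    rw [← Matrix.mul_assoc (U⁻¹).val, U.inv_mul, Matrix.one_mul]
  have hWinv : W * (U.val * A₁.map Polynomial.C) = 1 := by
    rw [hW, Matrix.mul_assoc, ← Matrix.mul_assoc (U⁻¹).val, U.inv_mul, Matrix.one_mul,
      ← Matrix.map_mul, Matrix.nonsing_inv_mul _ h, Matrix.map_one _ (map_zero _) (map_one _)]
  let δ : (Fin n → F[X]) →ₗ[F[X]] AEval' (Matrix.toLin' (-(A₁⁻¹ * A₀))) :=
    evalVec _ ∘ₗ W.mulVecLin
  have hδ : Function.Surjective δ := by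
    refine (evalVec_surjective _).comp fun x => ⟨(U.val * A₁.map Polynomial.C).mulVec x, ?_⟩
    rw [Matrix.mulVecLin_apply, Matrix.mulVec_mulVec, hWinv, Matrix.one_mulVec]
  have hδd (i : Fin n) : d i • δ (Pi.single i 1) = 0 := by
    rw [← map_smul]
    have : d i • (Pi.single i 1 : Fin n → F[X]) = (Matrix.diagonal d).mulVec (Pi.single i 1) := by
      ext1 j
      by_cases h : j = i
      · subst h; simp
      · simp [h]
    rw [this]
    change evalVec _ (W.mulVec _) = 0
    rw [Matrix.mulVec_mulVec, hWD, ← Matrix.mulVec_mulVec, evalVec_X_sub_mulVec]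
  refine CyclicSum.nonempty_linearEquiv (fun i => δ (Pi.single i.rev 1)) ?_ hf0 (fun i => ?_) ?_
  · rw [eq_top_iff]
    rintro y -
    obtain ⟨w, rfl⟩ := hδ y
    rw [pi_eq_sum_univ' w, map_sum]
    refine Submodule.sum_mem _ fun i _ => ?_
    rw [map_smul]
    refine Submodule.smul_mem _ _ (Submodule.subset_span ⟨i.rev, ?_⟩)
    simp only [Fin.rev_rev]
  · obtain ⟨c, hc⟩ := (hdf i).dvd
    rw [hc, mul_comm, mul_smul, hδd, smul_zero]
  · rw [(AEval'.of (Matrix.toLin' (-(A₁⁻¹ * A₀)))).symm.finrank_eq, finrank_fin_fun,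
      Finset.sum_range]
    refine hdeg.symm.trans ?_
    rw [← Equiv.sum_comp Fin.revPerm]
    refine Finset.sum_congr rfl fun i _ => ?_
    rw [Fin.revPerm_apply]
    exact natDegree_eq_of_degree_eq (degree_eq_degree_of_associated (hdf i))

theorem RankClose.exists_rank_sub_conj_le {C D : Matrix (Fin n) (Fin n) F} {r : ℕ}
    (h : RankClose F r (AEval' (Matrix.toLin' C)) (AEval' (Matrix.toLin' D))) :
    ∃ Θ : (Matrix (Fin n) (Fin n) F)ˣ, (C - Θ⁻¹.val * D * Θ.val).rank ≤ r := by
  obtain ⟨θ, hθ⟩ := h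
  let e := (AEval'.of (Matrix.toLin' C)).trans (θ.trans (AEval'.of (Matrix.toLin' D)).symm)
  have h1 : LinearMap.toMatrix' e.symm.toLinearMap * LinearMap.toMatrix' e.toLinearMap = 1 := by
    rw [← LinearMap.toMatrix'_comp, LinearEquiv.symm_comp, LinearMap.toMatrix'_id]
  have h2 : LinearMap.toMatrix' e.toLinearMap * LinearMap.toMatrix' e.symm.toLinearMap = 1 := by
    rw [← LinearMap.toMatrix'_comp, LinearEquiv.comp_symm, LinearMap.toMatrix'_id]
  refine ⟨⟨_, _, h2, h1⟩, ?_⟩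
  set E := Algebra.lsmul F F (AEval' (Matrix.toLin' C)) (X : F[X]) -
    θ.symm.toLinearMap ∘ₗ Algebra.lsmul F F _ (X : F[X]) ∘ₗ θ.toLinearMap with hE
  have h3 : (C - LinearMap.toMatrix' e.symm.toLinearMap * D *
      LinearMap.toMatrix' e.toLinearMap).mulVecLin =
      (AEval'.of (Matrix.toLin' C)).symm.toLinearMap ∘ₗ E ∘ₗ
        (AEval'.of (Matrix.toLin' C)).toLinearMap := by
    have h4 : (C - LinearMap.toMatrix' e.symm.toLinearMap * D *
      LinearMap.toMatrix' e.toLinearMap).mulVecLin =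
        Matrix.toLin' C - e.symm.toLinearMap ∘ₗ Matrix.toLin' D ∘ₗ e.toLinearMap := by
      rw [← Matrix.toLin'_apply', map_sub, Matrix.toLin'_mul, Matrix.toLin'_mul,
        Matrix.toLin'_toMatrix', Matrix.toLin'_toMatrix', LinearMap.comp_assoc]
    rw [h4]
    refine LinearMap.ext fun x => ?_
    obtain ⟨y, hy⟩ := (AEval'.of (Matrix.toLin' D)).surjective
      (θ (AEval'.of (Matrix.toLin' C) x))
    have h5 : e x = y := by simp [e, ← hy]
    simp only [hE, LinearMap.sub_apply, LinearMap.comp_apply, LinearEquiv.coe_coe, h5, ← hy,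
      Algebra.lsmul_coe, AEval'.X_smul_of, map_sub]
    simp [e]
  have h5 : ((AEval'.of (Matrix.toLin' C)).symm.toLinearMap ∘ₗ E ∘ₗ
        (AEval'.of (Matrix.toLin' C)).toLinearMap).rank ≤ r :=
    (LinearMap.rank_comp_le_right _ _).trans ((LinearMap.rank_comp_le_left _ _).trans hθ)
  rw [← h3] at h5
  exact Module.finrank_le_of_rank_le h5

end PencilModule

/-! ### Interlacing pencils -/

section InterlacingPencils

open Polynomial Module

variable {F : Type*} [Field F] {n : ℕ}

theorem dehomogenize_dvd {p q : MvPolynomial (Fin 2) F} (h : p ∣ q) :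
    dehomogenize p ∣ dehomogenize q := by
  obtain ⟨c, hc⟩ := h
  exact ⟨dehomogenize c, by rw [hc, map_mul]⟩

/-- The dehomogenized invariant factors in decreasing order, continued by `1`. -/
noncomputable def reverseIF (n : ℕ) (φ : ℕ → MvPolynomial (Fin 2) F) (j : ℕ) : F[X] :=
  if j < n then dehomogenize (φ (n - 1 - j)) else 1

theorem reverseIF_of_le {φ : ℕ → MvPolynomial (Fin 2) F} {j : ℕ} (hj : n ≤ j) :
    reverseIF n φ j = 1 :=
  if_neg (by omega)

theorem reverseIF_succ_dvd {φ : ℕ → MvPolynomial (Fin 2) F}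
    (hφ : ∀ i, i + 1 < n → φ i ∣ φ (i + 1)) (j : ℕ) :
    reverseIF n φ (j + 1) ∣ reverseIF n φ j := by
  rcases Nat.lt_or_ge (j + 1) n with h | h
  · rw [reverseIF, reverseIF, if_pos h, if_pos (by omega),
      show n - 1 - j = n - 1 - (j + 1) + 1 by omega]
    exact dehomogenize_dvd (hφ _ (by omega))
  · rw [reverseIF_of_le h]
    exact one_dvd _

theorem Interlace.reverseIF_dvd {φ ψ : ℕ → MvPolynomial (Fin 2) F} {r : ℕ}
    (h : Interlace n r φ ψ) (j : ℕ) :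
    reverseIF n φ (j + r) ∣ reverseIF n ψ j ∧ reverseIF n ψ (j + r) ∣ reverseIF n φ j := by
  rcases Nat.lt_or_ge (j + r) n with hj | hj
  · have h1 := (h (n - j) (by omega) (by omega)).1
    have h2 := (h (n - j - r) (by omega) (by omega)).2
    have ext (χ : ℕ → MvPolynomial (Fin 2) F) (i : ℤ) (l : ℕ) (hl : l < n) (hi : i = l + 1) :
        extIF n χ i = χ l := by
      rw [extIF, if_neg (by omega), if_neg (by omega)]
      congr 1
      omega
    rw [ext φ _ (n - 1 - (j + r)) (by omega) (by omega),
      ext ψ _ (n - 1 - j) (by omega) (by omega)] at h1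
    rw [ext φ _ (n - 1 - j) (by omega) (by omega),
      ext ψ _ (n - 1 - (j + r)) (by omega) (by omega)] at h2
    simp only [reverseIF, if_pos hj, if_pos (show j < n by omega)]
    exact ⟨dehomogenize_dvd h1, dehomogenize_dvd h2⟩
  · rw [reverseIF_of_le hj, reverseIF_of_le hj]
    exact ⟨one_dvd _, one_dvd _⟩

theorem IsHomogeneousIF.reverseIF_ne_zero_and_nonempty_linearEquiv
    {A₀ A₁ : Matrix (Fin n) (Fin n) F} {φ : ℕ → MvPolynomial (Fin 2) F}
    (hφ : IsHomogeneousIF A₀ A₁ φ) (h : IsUnit A₁.det) :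
    (∀ i, reverseIF n φ i ≠ 0) ∧ Nonempty (CyclicSum n (reverseIF n φ) ≃ₗ[F[X]]
      AEval' (Matrix.toLin' (-(A₁⁻¹ * A₀)))) := by
  obtain ⟨d, hd, hdφ⟩ := hφ.exists_diagonal h.ne_zero
  have hd0 := (hd.sum_natDegree h.ne_zero).1
  have hdf (i : Fin n) : Associated (d i.rev) (reverseIF n φ i) := by
    rw [reverseIF, if_pos i.2, show n - 1 - (i : ℕ) = (i.rev : ℕ) by rw [Fin.val_rev]; omega]
    exact hdφ i.rev
  have hf0 (i : ℕ) : reverseIF n φ i ≠ 0 := by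
    rcases Nat.lt_or_ge i n with hi | hi
    · exact (hdf ⟨i, hi⟩).ne_zero_iff.1 (hd0 _)
    · rw [reverseIF_of_le hi]
      exact one_ne_zero
  exact ⟨hf0, exists_cyclicSum_linearEquiv_aeval h hd hf0 hdf⟩

theorem exists_rank_sub_conj_le_of_interlace (hn : 0 < n) {A₀ A₁ B₀ B₁ : Matrix (Fin n) (Fin n) F}
    (hA1 : IsUnit A₁.det) (hB1 : IsUnit B₁.det) {φ ψ : ℕ → MvPolynomial (Fin 2) F}
    (hφ : IsHomogeneousIF A₀ A₁ φ) (hφc : ∀ i, i + 1 < n → φ i ∣ φ (i + 1))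
    (hψ : IsHomogeneousIF B₀ B₁ ψ) (hψc : ∀ i, i + 1 < n → ψ i ∣ ψ (i + 1))
    {r : ℕ} (hint : Interlace n r φ ψ) :
    ∃ Θ : (Matrix (Fin n) (Fin n) F)ˣ,
      (-(A₁⁻¹ * A₀) - Θ⁻¹.val * -(B₁⁻¹ * B₀) * Θ.val).rank ≤ r := by
  obtain ⟨hf0, ⟨eA⟩⟩ := hφ.reverseIF_ne_zero_and_nonempty_linearEquiv hA1
  obtain ⟨hg0, ⟨eB⟩⟩ := hψ.reverseIF_ne_zero_and_nonempty_linearEquiv hB1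
  have hunit (χ : ℕ → MvPolynomial (Fin 2) F) (i : ℕ) (hi : n ≤ i) : IsUnit (reverseIF n χ i) := by
    rw [reverseIF_of_le hi]
    exact isUnit_one
  have hdeg : ∑ i ∈ Finset.range n, (reverseIF n φ i).natDegree =
      ∑ i ∈ Finset.range n, (reverseIF n ψ i).natDegree := by
    rw [← CyclicSum.finrank fun i _ => hf0 i, ← CyclicSum.finrank fun i _ => hg0 i,
      (eA.restrictScalars F).finrank_eq, (eB.restrictScalars F).finrank_eq,
      (AEval'.of (Matrix.toLin' (-(A₁⁻¹ * A₀)))).symm.finrank_eq,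
      (AEval'.of (Matrix.toLin' (-(B₁⁻¹ * B₀)))).symm.finrank_eq]
  have h := RankClose.cyclicSum_of_interlacing n r hf0 hg0 (reverseIF_succ_dvd hφc)
    (reverseIF_succ_dvd hψc) (hunit φ) (hunit ψ) (fun j => (hint.reverseIF_dvd j).1)
    (fun j => (hint.reverseIF_dvd j).2) hdeg hn
  refine RankClose.exists_rank_sub_conj_le ?_
  have := ((RankClose.of_linearEquiv eA.symm).trans h).trans (RankClose.of_linearEquiv eB)
  rwa [zero_add, add_zero] at this

end InterlacingPencils

/-! ### Adjusting the rank -/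

section RankAdjust

namespace Matrix

theorem rank_add_le {K m n : Type*} [Field K] [Fintype m] [Fintype n] (M N : Matrix m n K) :
    (M + N).rank ≤ M.rank + N.rank := by
  rw [rank, rank, rank, mulVecLin_add]
  refine (Submodule.finrank_mono ?_).trans (Submodule.finrank_add_le_finrank_add_finrank _ _)
  exact LinearMap.range_add_le _ _

theorem rank_map_le {F K n : Type*} [Field F] [Field K] [Fintype n] [DecidableEq n]
    (f : F →+* K) (M : Matrix n n F) : (M.map f).rank ≤ M.rank := by
  obtain ⟨V, U, e, hV, hU, h⟩ := exists_rank_normal_form M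
  have h1 : V.map f * M.map f * U.map f =
      (fromBlocks 1 0 0 0 : Matrix (Fin M.rank ⊕ Fin (Fintype.card n - M.rank))
        (Fin M.rank ⊕ Fin (Fintype.card n - M.rank)) K).submatrix e e := by
    rw [← Matrix.map_mul, ← Matrix.map_mul, h, ← submatrix_map, fromBlocks_map]
    simp
  have hdet {W : Matrix n n F} (hW : IsUnit W) : IsUnit (W.map f).det := by
    have := ((isUnit_iff_isUnit_det W).1 hW).map f
    rwa [RingHom.map_det] at this
  rw [← rank_mul_eq_right_of_isUnit_det _ (M.map f) (hdet hV),
    ← rank_mul_eq_left_of_isUnit_det _ (V.map f * M.map f) (hdet hU), h1, rank_submatrix]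
  have h2 : (fromBlocks 1 0 0 0 : Matrix (Fin M.rank ⊕ Fin (Fintype.card n - M.rank))
      (Fin M.rank ⊕ Fin (Fintype.card n - M.rank)) K) =
        fromRows (1 : Matrix (Fin M.rank) (Fin M.rank) K) 0 *
          fromCols (1 : Matrix (Fin M.rank) (Fin M.rank) K) 0 := by
    rw [fromRows_mul_fromCols]
    simp
  rw [h2]
  exact (rank_mul_le_left _ _).trans ((rank_le_card_width _).trans_eq (Fintype.card_fin _))

variable {F K n : Type*} [Field F] [Field K] [Fintype n] [DecidableEq n] (f : F →+* K)

theorem rank_map_one_add_single_mul_sub_le (i j : n) (c : F) (A C : Matrix n n K) :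
    ((1 + single i j c : Matrix n n F).map f * C - A).rank ≤ (C - A).rank + 1 := by
  have h1 : ((1 + single i j c : Matrix n n F).map f * C - A) =
      (C - A) + single i j (f c) * C := by
    rw [Matrix.map_add f (map_add f), Matrix.map_one f (map_zero f) (map_one f),
      map_single, add_mul, one_mul]
    abel
  have h2 : (single i j (f c)).rank ≤ 1 := by
    rw [← mul_one (f c), ← smul_eq_mul, ← smul_single, single_eq_single_vecMulVec_single,
      ← smul_vecMulVec]
    exact rank_vecMulVec_le _ _
  rw [h1]
  exact (rank_add_le _ _).trans (by gcongr; exact (rank_mul_le_left _ _).trans h2)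

/-- Multiplying `C` by elementary matrices changes the rank of `C - A` in steps of at most one. -/
theorem exists_rank_map_mul_sub_eq {A C : Matrix n n K} {r : ℕ} (h : (C - A).rank ≤ r)
    {M : Matrix n n F} (hM : M.det ≠ 0) (hr : r ≤ (M.map f * C - A).rank) :
    ∃ Q : Matrix n n F, Q.det ≠ 0 ∧ (Q.map f * C - A).rank = r := by
  let P (N : Matrix n n F) : Prop := ∀ C : Matrix n n K, (C - A).rank ≤ r →
    (∃ Q : Matrix n n F, Q.det ≠ 0 ∧ (Q.map f * C - A).rank = r) ∨
      (N.map f * C - A).rank ≤ r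
  have hmul (N N' : Matrix n n F) (hN : N.det ≠ 0) (hN' : N'.det ≠ 0) (h1 : P N) (h2 : P N') :
      P (N * N') := by
    intro C hC
    rcases h2 C hC with h | h
    · exact Or.inl h
    · rcases h1 _ h with ⟨Q, hQ, hQr⟩ | h
      · refine Or.inl ⟨Q * N', by rw [det_mul]; exact mul_ne_zero hQ hN', ?_⟩
        rwa [Matrix.map_mul, Matrix.mul_assoc]
      · right
        rwa [Matrix.map_mul, Matrix.mul_assoc]
  have hone : (1 : Matrix n n F).map f = 1 := Matrix.map_one f (map_zero f) (map_one f)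
  have hel (i j : n) (c : F) : P (1 + single i j c) := by
    intro C hC
    rcases hC.lt_or_eq with h | h
    · right
      have := rank_map_one_add_single_mul_sub_le f i j c A C
      omega
    · exact Or.inl ⟨1, by simp, by rwa [hone, one_mul]⟩
  have hdiag (D : n → F) (hD : (diagonal D).det ≠ 0) : P (diagonal D) := by
    have hD' : ∀ i, D i ≠ 0 := by
      rw [det_diagonal, Finset.prod_ne_zero_iff] at hD
      exact fun i => hD i (Finset.mem_univ i)
    have key (s : Finset n) : P (diagonal fun i => if i ∈ s then D i else 1) := by
      induction s using Finset.induction_on with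
      | empty =>
        intro C hC
        right
        simpa [hone] using hC
      | insert a s ha ih =>
        have h1 : (1 + single a a (D a - 1) : Matrix n n F) =
            diagonal fun i => if i = a then D a else 1 := by
          ext i j
          rcases eq_or_ne i j with rfl | hij
          · rcases eq_or_ne i a with rfl | hia
            · simp
            · simp [hia, hia.symm]
          · rw [diagonal_apply_ne _ hij, add_apply, one_apply_ne hij, single_apply_of_ne, add_zero]
            rintro ⟨rfl, rfl⟩
            exact hij rfl
        have h2 : (diagonal fun i => if i ∈ insert a s then D i else 1) =
            (1 + single a a (D a - 1)) * diagonal fun i => if i ∈ s then D i else 1 := by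
          rw [h1, diagonal_mul_diagonal]
          congr 1
          ext i
          rcases eq_or_ne i a with rfl | hia
          · simp [ha]
          · simp [hia]
        rw [h2]
        refine hmul _ _ ?_ ?_ (hel _ _ _) ih
        · rw [h1, det_diagonal, Finset.prod_ne_zero_iff]
          intro i _
          split_ifs
          exacts [hD' a, one_ne_zero]
        · rw [det_diagonal, Finset.prod_ne_zero_iff]
          intro i _
          split_ifs
          exacts [hD' i, one_ne_zero]
    simpa using key Finset.univ
  have hall : P M := diagonal_transvection_induction_of_det_ne_zero P M hM hdiag
    (fun t => hel _ _ _) hmul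
  rcases hall C h with h | h
  · exact h
  · exact ⟨M, hM, h.antisymm hr⟩

/-- Over every field there is an invertible matrix of size at least two without eigenvalue one. -/
theorem exists_isUnit_det_and_isUnit_det_sub_one (F : Type*) [Field F] {n : ℕ} (hn : 2 ≤ n) :
    ∃ T : Matrix (Fin n) (Fin n) F, IsUnit T.det ∧ IsUnit (T - 1).det := by
  obtain ⟨m, rfl⟩ := Nat.exists_eq_add_of_le' hn
  let g : Polynomial F := Polynomial.X ^ (m + 2) + (1 - Polynomial.X ^ (m + 1))
  have hlt : (1 - Polynomial.X ^ (m + 1) : Polynomial F).degree < (m + 2 : ℕ) := by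
    refine (Polynomial.degree_sub_le _ _).trans_lt (max_lt ?_ ?_)
    · rw [Polynomial.degree_one]
      exact_mod_cast Nat.succ_pos _
    · rw [Polynomial.degree_X_pow]
      exact_mod_cast Nat.lt_succ_self _
  have hg : g.Monic := Polynomial.monic_X_pow_add hlt
  have hdeg : g.natDegree = m + 2 := by
    rw [Polynomial.natDegree_eq_of_degree_eq_some]
    rw [Polynomial.degree_add_eq_left_of_degree_lt, Polynomial.degree_X_pow]
    rwa [Polynomial.degree_X_pow]
  let b := (AdjoinRoot.powerBasis' hg).basis.reindex
    (finCongr ((AdjoinRoot.powerBasis'_dim hg).trans hdeg))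
  let x := AdjoinRoot.root g
  have hx : x ^ (m + 1) * (x - 1) = -1 := by
    have h : x ^ (m + 2) + (1 - x ^ (m + 1)) = 0 := by
      have := AdjoinRoot.mk_self (f := g)
      rwa [map_add, map_sub, map_pow, map_pow, map_one] at this
    linear_combination h
  have hu (y : AdjoinRoot g) (hy : IsUnit y) : IsUnit (Algebra.leftMulMatrix b y).det :=
    (isUnit_iff_isUnit_det _).1 (hy.map (Algebra.leftMulMatrix b))
  have hprod : IsUnit (x ^ (m + 1) * (x - 1)) := hx ▸ isUnit_one.neg
  refine ⟨Algebra.leftMulMatrix b x, hu x ?_, ?_⟩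
  · exact isUnit_of_dvd_unit ((dvd_pow_self x m.succ_ne_zero).mul_right _) hprod
  · rw [← map_one (Algebra.leftMulMatrix b), ← map_sub]
    exact hu _ (isUnit_of_dvd_unit (dvd_mul_left _ _) hprod)

end Matrix

end RankAdjust

/-! ### Rank perturbations of pencils -/

section PencilRank

variable {F : Type*} [Field F] {n : ℕ}

theorem isPencil_pencilOf (G₀ G₁ : Matrix (Fin n) (Fin n) F) : IsPencil (pencilOf G₀ G₁) := by
  intro i j
  rw [pencilOf, Matrix.add_apply, Matrix.smul_apply, Matrix.map_apply, Matrix.map_apply,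
    smul_eq_mul, add_comm, mul_comm]
  exact Polynomial.degree_linear_le

theorem pencilOf_add (G₀ G₁ H₀ H₁ : Matrix (Fin n) (Fin n) F) :
    pencilOf G₀ G₁ + pencilOf H₀ H₁ = pencilOf (G₀ + H₀) (G₁ + H₁) := by
  simp only [pencilOf, Matrix.map_add Polynomial.C (map_add Polynomial.C), smul_add]
  abel

theorem map_C_mul_pencilOf (Q G₀ G₁ : Matrix (Fin n) (Fin n) F) :
    Q.map Polynomial.C * pencilOf G₀ G₁ = pencilOf (Q * G₀) (Q * G₁) := by
  simp only [pencilOf, Matrix.map_mul, mul_add, Matrix.mul_smul]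

theorem pencilOf_mul_map_C (G₀ G₁ R : Matrix (Fin n) (Fin n) F) :
    pencilOf G₀ G₁ * R.map Polynomial.C = pencilOf (G₀ * R) (G₁ * R) := by
  simp only [pencilOf, Matrix.map_mul, add_mul, Matrix.smul_mul]

/-- A pencil close to `A₀ + s A₁` with the same leading coefficient can be multiplied by a
constant invertible matrix so as to differ from `A₀ + s A₁` in normal rank exactly `r`. -/
theorem exists_normalRank_pencilOf_sub_eq (hn : 2 ≤ n) {A₀ A₁ G₀ : Matrix (Fin n) (Fin n) F}
    (hA₁ : IsUnit A₁.det) {r : ℕ} (hr : r ≤ n) (h : (G₀ - A₀).rank ≤ r) :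
    ∃ Q : Matrix (Fin n) (Fin n) F, Q.det ≠ 0 ∧
      normalRank (pencilOf (Q * G₀ - A₀) (Q * A₁ - A₁)) = r := by
  let ι := algebraMap (Polynomial F) (RatFunc F)
  let f : F →+* RatFunc F := ι.comp Polynomial.C
  have hsub (Q : Matrix (Fin n) (Fin n) F) :
      (pencilOf (Q * G₀ - A₀) (Q * A₁ - A₁)).map ι =
        Q.map f * (pencilOf G₀ A₁).map ι - (pencilOf A₀ A₁).map ι := by
    have h1 : Q.map f = (Q.map Polynomial.C).map ι := by
      rw [Matrix.map_map]
      rfl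
    rw [h1, ← Matrix.map_mul, map_C_mul_pencilOf, eq_sub_iff_add_eq,
      ← Matrix.map_add ι (map_add ι), pencilOf_add, sub_add_cancel, sub_add_cancel]
  obtain ⟨T, hT, hT1⟩ := Matrix.exists_isUnit_det_and_isUnit_det_sub_one F hn
  have hA : IsUnit A₁⁻¹.det := (Matrix.isUnit_nonsing_inv_det_iff).2 hA₁
  have hlow : ((pencilOf G₀ A₁).map ι - (pencilOf A₀ A₁).map ι).rank ≤ r := by
    have h1 := hsub 1
    rw [one_mul, one_mul, Matrix.map_one f (map_zero f) (map_one f), one_mul] at h1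
    rw [← h1, sub_self]
    have h2 : (pencilOf (G₀ - A₀) 0).map ι = (G₀ - A₀).map f := by
      ext i j
      simp [pencilOf, f]
    rw [h2]
    exact (Matrix.rank_map_le f _).trans h
  have hM : (A₁ * T * A₁⁻¹).det ≠ 0 := by
    rw [Matrix.det_mul, Matrix.det_mul]
    exact ((hA₁.mul hT).mul hA).ne_zero
  have hup : r ≤ ((A₁ * T * A₁⁻¹).map f * (pencilOf G₀ A₁).map ι -
      (pencilOf A₀ A₁).map ι).rank := by
    rw [← hsub, Matrix.rank_of_det_ne_zero, Fintype.card_fin]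
    · exact hr
    · have h1 : A₁ * T * A₁⁻¹ * A₁ - A₁ = A₁ * (T - 1) := by
        rw [Matrix.nonsing_inv_mul_cancel_right _ _ hA₁, mul_sub, mul_one]
      have h2 : (A₁ * T * A₁⁻¹ * A₁ - A₁).det ≠ 0 := by
        rw [h1, Matrix.det_mul]
        exact (hA₁.mul hT1).ne_zero
      have h3 := det_pencilOf_ne_zero (A₁ * T * A₁⁻¹ * G₀ - A₀) h2
      rw [← RingHom.mapMatrix_apply, ← RingHom.map_det]
      exact (map_ne_zero_iff ι (IsFractionRing.injective _ _)).2 h3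
  obtain ⟨Q, hQ, hQr⟩ := Matrix.exists_rank_map_mul_sub_eq f hlow hM hup
  exact ⟨Q, hQ, by rw [normalRank, hsub, hQr]⟩

end PencilRank

/-- For `n ≥ 2` and pencils `A(s) = A₀ + sA₁`, `B(s) = B₀ + sB₁` with
invertible leading coefficients and homogeneous invariant factors `φ`, `ψ`, if the
interlacing conditions hold for `0 ≤ r ≤ n` then there is a pencil of normal rank exactly
`r` taking `A(s)` to (a pencil strictly equivalent to) `B(s)`. -/
theorem stmt11 (F : Type*) [Field F] (n : ℕ) (hn : 2 ≤ n)
    (A₀ A₁ B₀ B₁ : Matrix (Fin n) (Fin n) F)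
    (hA1 : IsUnit A₁.det) (hB1 : IsUnit B₁.det)
    (φ ψ : ℕ → MvPolynomial (Fin 2) F)
    (hφ : IsHomogeneousIF A₀ A₁ φ) (hφc : ∀ i, i + 1 < n → φ i ∣ φ (i + 1))
    (hψ : IsHomogeneousIF B₀ B₁ ψ) (hψc : ∀ i, i + 1 < n → ψ i ∣ ψ (i + 1))
    (r : ℕ) (hr : r ≤ n) (hint : Interlace n r φ ψ) :
    ∃ P : Matrix (Fin n) (Fin n) (Polynomial F), IsPencil P ∧ normalRank P = r ∧
      StrictEquiv (pencilOf A₀ A₁ + P) (pencilOf B₀ B₁) := by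
  obtain ⟨Θ, hΘ⟩ :=
    exists_rank_sub_conj_le_of_interlace (by omega) hA1 hB1 hφ hφc hψ hψc hint
  have hG : A₁ * (Θ⁻¹.val * (B₁⁻¹ * B₀) * Θ.val) - A₀ =
      A₁ * (-(A₁⁻¹ * A₀) - Θ⁻¹.val * -(B₁⁻¹ * B₀) * Θ.val) := by
    rw [mul_sub, mul_neg, Matrix.mul_nonsing_inv_cancel_left _ _ hA1, mul_neg, neg_mul, mul_neg]
    abel
  have hrank : (A₁ * (Θ⁻¹.val * (B₁⁻¹ * B₀) * Θ.val) - A₀).rank ≤ r := by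
    rw [hG]
    exact (Matrix.rank_mul_le_right _ _).trans hΘ
  obtain ⟨Q, hQ, hQr⟩ := exists_normalRank_pencilOf_sub_eq hn hA1 hr hrank
  refine ⟨_, isPencil_pencilOf _ _, hQr, Q * A₁ * Θ⁻¹.val * B₁⁻¹, Θ.val, ?_, ?_, ?_⟩
  · rw [Matrix.det_mul, Matrix.det_mul, Matrix.det_mul]
    exact ((hQ.isUnit.mul hA1).mul ((Matrix.isUnit_iff_isUnit_det _).1 Θ⁻¹.isUnit)).mul
      (Matrix.isUnit_nonsing_inv_det_iff.2 hB1)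
  · exact (Matrix.isUnit_iff_isUnit_det _).1 Θ.isUnit
  · rw [pencilOf_add, add_sub_cancel, add_sub_cancel, map_C_mul_pencilOf, pencilOf_mul_map_C]
    congr 1
    · simp only [mul_assoc]
    · rw [Matrix.nonsing_inv_mul_cancel_right _ _ hB1, mul_assoc, Units.inv_mul, mul_one]
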